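/- arXiv:1805.12508 — 2 statements merged into one kernel-verified Lean document; each statement's English description precedes it below -/
import Mathlib

section
/- For every finite simple graph G with at least one edge, there exists a vertex w of G such that min-match_{K2,C5}(G − N_G[w]) ≤ min-match_{K2,C5}(G) − 1. -/
open SimpleGraph

namespace Paper

/-- The complete graph on two vertices, `K₂`. -/
def k2 : SimpleGraph (Fin 2) := ⊤

/-- The 5-cycle `C₅`. -/
def cycle5 : SimpleGraph (ZMod 5) := SimpleGraph.fromRel (fun a b => b = a + 1)

/-- A graph is chordal if it has no induced cycle of length at least four. -/
def IsChordal {V : Type*} (G : SimpleGraph V) : Prop :=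
  ∀ n : ℕ, 4 ≤ n → IsEmpty (SimpleGraph.cycleGraph n ↪g G)

/-- A graph is co-chordal if its complement is chordal. -/
def IsCochordal {V : Type*} (G : SimpleGraph V) : Prop := IsChordal Gᶜ

/-- The co-chordal cover number: the minimum number of co-chordal subgraphs of `G`
needed to cover all edges of `G`. -/
noncomputable def cochord {V : Type*} (G : SimpleGraph V) : ℕ :=
  sInf { t | ∃ f : Fin t → SimpleGraph V,
    (∀ i, f i ≤ G ∧ IsCochordal (f i)) ∧ ∀ ⦃u v : V⦄, G.Adj u v → ∃ i, (f i).Adj u v }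

/-- The closed neighborhood `N_G[w]`. -/
def closedNbhd {V : Type*} (G : SimpleGraph V) (w : V) : Set V :=
  insert w (G.neighborSet w)

/-- The graph `G - N_G[w]`: the induced subgraph on the complement of the closed
neighborhood of `w`. -/
def delClosedNbhd {V : Type*} (G : SimpleGraph V) (w : V) :
    SimpleGraph ((closedNbhd G w)ᶜ : Set V) := G.induce _

/-- A maximal matching: a matching such that no edge of `G` is disjoint from all of
its edges. -/
def IsMaximalMatching {V : Type*} (G : SimpleGraph V) (M : G.Subgraph) : Prop :=
  M.IsMatching ∧ ∀ ⦃u v : V⦄, G.Adj u v → u ∈ M.support ∨ v ∈ M.support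

/-- The minimum matching number: the minimum cardinality of a maximal matching. -/
noncomputable def minMatch {V : Type*} (G : SimpleGraph V) : ℕ :=
  sInf { k | ∃ M : G.Subgraph, IsMaximalMatching G M ∧ M.edgeSet.ncard = k }

/-- The matching number of a graph: maximum cardinality of a matching. -/
noncomputable def matchNum {V : Type*} (G : SimpleGraph V) : ℕ :=
  sSup { k | ∃ M : G.Subgraph, M.IsMatching ∧ M.edgeSet.ncard = k }

/-- A graph all of whose connected components are isomorphic to `K₂` or `C₅`. -/
def IsK2C5Graph {V : Type*} (G : SimpleGraph V) : Prop :=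
  ∀ c : G.ConnectedComponent,
    Nonempty (G.induce c.supp ≃g k2) ∨ Nonempty (G.induce c.supp ≃g cycle5)

/-- A maximal `{K₂, C₅}`-subgraph of `G`: a subgraph whose components are all `K₂` or
`C₅` such that the induced subgraph of `G` on the vertices outside it has no edge. -/
def IsMaximalK2C5Subgraph {V : Type*} (G : SimpleGraph V) (H : G.Subgraph) : Prop :=
  IsK2C5Graph H.coe ∧ ∀ ⦃u v : V⦄, G.Adj u v → u ∈ H.verts ∨ v ∈ H.verts

/-- `min-match_{K₂,C₅}(G)`: the minimum matching number of a maximal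
`{K₂, C₅}`-subgraph of `G` (with value `0` if `G` has no edge, via `sInf ∅ = 0`:
if `G` is edgeless the empty subgraph is a maximal `{K₂,C₅}`-subgraph). -/
noncomputable def minMatchK2C5 {V : Type*} (G : SimpleGraph V) : ℕ :=
  sInf { k | ∃ H : G.Subgraph, IsMaximalK2C5Subgraph G H ∧ matchNum H.coe = k }

/-- An induced matching of `G`. -/
def IsInducedMatching {V : Type*} (G : SimpleGraph V) (M : G.Subgraph) : Prop :=
  M.IsMatching ∧ ∀ ⦃u v : V⦄, G.Adj u v → u ∈ M.support → v ∈ M.support → M.Adj u v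

/-- The induced matching number of `G`. -/
noncomputable def indMatch {V : Type*} (G : SimpleGraph V) : ℕ :=
  sSup { k | ∃ M : G.Subgraph, IsInducedMatching G M ∧ M.edgeSet.ncard = k }

/-- `ind-match_{K₂,C₅}(G)`: the maximum matching number of an induced subgraph of `G`
all of whose connected components are `K₂` or `C₅`. -/
noncomputable def indMatchK2C5 {V : Type*} (G : SimpleGraph V) : ℕ :=
  sSup { k | ∃ s : Set V, IsK2C5Graph (G.induce s) ∧ matchNum (G.induce s) = k }

/-- `IsTiled G X k`: the set `X` is partitioned into (vertex sets of) edges and 5-cycles of `G`,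
where `k` counts each edge once and each 5-cycle twice. -/
inductive IsTiled {V : Type*} (G : SimpleGraph V) : Set V → ℕ → Prop
  | empty : IsTiled G ∅ 0
  | edge {X : Set V} {k : ℕ} (h : IsTiled G X k) {u v : V} (huv : G.Adj u v)
      (hu : u ∉ X) (hv : v ∉ X) : IsTiled G (X ∪ {u, v}) (k + 1)
  | cycle {X : Set V} {k : ℕ} (h : IsTiled G X k) (f : ZMod 5 ↪ V)
      (hf : ∀ i, G.Adj (f i) (f (i + 1))) (hX : ∀ i, f i ∉ X) :
      IsTiled G (X ∪ Set.range f) (k + 2)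

lemma cycle5_adj_succ (i : ZMod 5) : cycle5.Adj i (i + 1) := by
  simp only [cycle5, SimpleGraph.fromRel_adj]
  revert i; decide

lemma k2_connected : k2.Preconnected := by
  unfold k2; exact SimpleGraph.preconnected_top

lemma cycle5_connected : cycle5.Preconnected := by
  have h : ∀ n : ℕ, cycle5.Reachable 0 (n : ZMod 5) := by
    intro n
    induction n with
    | zero => simp
    | succ n ih => exact ih.trans (by simpa using (cycle5_adj_succ (n : ZMod 5)).reachable)
  have h' : ∀ i : ZMod 5, cycle5.Reachable 0 i := fun i => by
    simpa using h i.val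
  exact fun i j => (h' i).symm.trans (h' j)

lemma IsTiled.map {V W : Type*} {G : SimpleGraph V} {G' : SimpleGraph W} (φ : V ↪ W)
    (hφ : ∀ u v, G.Adj u v → G'.Adj (φ u) (φ v)) {X : Set V} {k : ℕ} (h : IsTiled G X k) :
    IsTiled G' (φ '' X) k := by
  induction h with
  | empty => simpa using IsTiled.empty
  | edge h huv hu hv ih =>
    rw [Set.image_union, Set.image_pair]
    exact ih.edge (hφ _ _ huv) (by simpa using hu) (by simpa using hv)
  | cycle h f hf hX ih =>
    rw [Set.image_union, ← Set.range_comp]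
    exact ih.cycle (f.trans φ) (fun i => hφ _ _ (hf i)) (by simpa using hX)

lemma IsTiled.induce {V : Type*} {G : SimpleGraph V} (Z : Set V) {X : Set V} {k : ℕ}
    (h : IsTiled G X k) (hXZ : X ⊆ Z) :
    IsTiled (G.induce Z) (Subtype.val ⁻¹' X) k := by
  induction h with
  | empty => simpa using IsTiled.empty
  | @edge X k h u v huv hu hv ih =>
    obtain ⟨hX, huvZ⟩ := Set.union_subset_iff.1 hXZ
    have := (ih hX).edge (u := ⟨u, huvZ (by simp)⟩) (v := ⟨v, huvZ (by simp)⟩) huv hu hv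
    convert this using 1
    ext ⟨x, hx⟩
    simp
  | @cycle X k h f hf hX ih =>
    obtain ⟨hXZ, hfZ⟩ := Set.union_subset_iff.1 hXZ
    have := (ih hXZ).cycle
      ⟨fun i => ⟨f i, hfZ ⟨i, rfl⟩⟩, fun i j hij => f.injective (by simpa using hij)⟩
      (fun i => hf i) (fun i => hX i)
    convert this using 1
    ext ⟨x, hx⟩
    exact or_congr_right (exists_congr fun i =>
      ⟨fun h => Subtype.ext h, fun h => congrArg Subtype.val h⟩)

lemma exists_isMatching_sup_edge {V : Type*} [Finite V] {G : SimpleGraph V} {X : Set V} {k : ℕ}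
    (h : ∃ M : G.Subgraph, M.IsMatching ∧ M.verts ⊆ X ∧ M.edgeSet.ncard = k)
    {u v : V} (huv : G.Adj u v) (hu : u ∉ X) (hv : v ∉ X) :
    ∃ M : G.Subgraph, M.IsMatching ∧ M.verts ⊆ X ∪ {u, v} ∧ M.edgeSet.ncard = k + 1 := by
  obtain ⟨M, hM, hMX, rfl⟩ := h
  have hu' : u ∉ M.verts := fun h => hu (hMX h)
  have hv' : v ∉ M.verts := fun h => hv (hMX h)
  refine ⟨M ⊔ G.subgraphOfAdj huv, hM.sup (Subgraph.IsMatching.subgraphOfAdj huv) ?_, ?_, ?_⟩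
  · rw [hM.support_eq_verts, (Subgraph.IsMatching.subgraphOfAdj huv).support_eq_verts]
    rw [Set.disjoint_right]
    rintro x hx
    rcases hx with rfl | rfl <;> assumption
  · exact Set.union_subset_union hMX subset_rfl
  · rw [Subgraph.edgeSet_sup, edgeSet_subgraphOfAdj, Set.union_singleton,
      Set.ncard_insert_of_notMem _ (Set.toFinite _)]
    intro h
    exact hu' (Subgraph.Adj.fst_mem (Subgraph.mem_edgeSet.1 h))

lemma IsTiled.exists_isMatching {V : Type*} [Finite V] {G : SimpleGraph V} {X : Set V} {k : ℕ}
    (h : IsTiled G X k) :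
    ∃ M : G.Subgraph, M.IsMatching ∧ M.verts ⊆ X ∧ M.edgeSet.ncard = k := by
  induction h with
  | empty => exact ⟨⊥, by simp [Subgraph.IsMatching], by simp, by simp⟩
  | edge h huv hu hv ih => exact exists_isMatching_sup_edge ih huv hu hv
  | cycle h f hf hX ih =>
    obtain ⟨M, hM, hMX, hc⟩ := exists_isMatching_sup_edge
      (exists_isMatching_sup_edge ih (hf 0) (hX 0) (hX _)) (hf 2)
      (by simp [hX]; decide) (by simp [hX]; decide)
    refine ⟨M, hM, hMX.trans ?_, hc⟩
    rintro x ((hx | rfl | rfl) | rfl | rfl) <;> simp_all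

lemma IsTiled.le_matchNum {V : Type*} [Finite V] {G : SimpleGraph V} {X : Set V} {k : ℕ}
    (h : IsTiled G X k) : k ≤ matchNum G := by
  obtain ⟨M, hM, -, hk⟩ := h.exists_isMatching
  refine le_csSup ⟨Nat.card (Sym2 V), ?_⟩ ⟨M, hM, hk⟩
  rintro _ ⟨M, -, rfl⟩
  exact Set.ncard_le_card _

lemma IsK2C5Graph.exists_isTiled {V : Type*} [Finite V] {G : SimpleGraph V}
    (hG : IsK2C5Graph G) : ∃ k, IsTiled G Set.univ k := by
  classical
  have := Fintype.ofFinite G.ConnectedComponent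
  have key : ∀ C : Finset G.ConnectedComponent, ∃ k, IsTiled G (⋃ c ∈ C, c.supp) k := by
    intro C
    induction C using Finset.induction_on with
    | empty => exact ⟨0, by simpa using IsTiled.empty⟩
    | insert c C hc ih =>
      obtain ⟨k, hk⟩ := ih
      have hdisj : ∀ x : c.supp, x.1 ∉ ⋃ c ∈ C, c.supp := by
        rintro ⟨x, rfl⟩ hx
        simp only [Set.mem_iUnion] at hx
        obtain ⟨d, hd, rfl⟩ := hx
        exact hc hd
      rw [Finset.set_biUnion_insert, Set.union_comm]
      rcases hG c with ⟨⟨e⟩⟩ | ⟨⟨e⟩⟩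
      · have hadj : k2.Adj 0 1 := by simp [k2]
        have := hk.edge (show G.Adj (e.symm 0).1 (e.symm 1).1 from e.symm.map_rel_iff.2 hadj)
          (hdisj _) (hdisj _)
        refine ⟨k + 1, ?_⟩
        convert this using 2
        ext x
        constructor
        · intro hx
          obtain ⟨i, hi⟩ := e.symm.surjective ⟨x, hx⟩
          obtain rfl : (e.symm i).1 = x := by rw [hi]
          fin_cases i <;> simp
        · rintro (rfl | rfl) <;> exact Subtype.property _
      · have := hk.cycle ⟨fun i => (e.symm i).1, fun i j hij =>
            e.symm.injective (Subtype.ext hij)⟩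
          (fun i => show G.Adj (e.symm i).1 (e.symm (i + 1)).1 from
            e.symm.map_rel_iff.2 (cycle5_adj_succ i)) (fun i => hdisj _)
        refine ⟨k + 2, ?_⟩
        convert this using 2
        ext x
        constructor
        · intro hx
          obtain ⟨i, hi⟩ := e.symm.surjective ⟨x, hx⟩
          exact ⟨i, congrArg Subtype.val hi⟩
        · rintro ⟨i, rfl⟩
          exact Subtype.property _
  obtain ⟨k, hk⟩ := key Finset.univ
  refine ⟨k, ?_⟩
  convert hk
  ext x
  simp

/-- `f` embeds `A` as a union of connected components of `R`, inside `X`. -/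
def IsPiece {α V : Type*} (A : SimpleGraph α) (R : SimpleGraph V) (X : Set V) (f : α ↪ V) : Prop :=
  (∀ i, f i ∈ X) ∧ ∀ i x, R.Adj (f i) x ↔ ∃ j, A.Adj i j ∧ f j = x

/-- `s` is a set of pairwise disjoint edges of `R`. -/
def IsEdgePacking {V : Type*} (R : SimpleGraph V) (s : Finset (Sym2 V)) : Prop :=
  (∀ e ∈ s, e ∈ R.edgeSet) ∧ ∀ e ∈ s, ∀ e' ∈ s, ∀ v, v ∈ e → v ∈ e' → e = e'

lemma IsEdgePacking.two_mul_card_le {V : Type*} {R : SimpleGraph V} {s : Finset (Sym2 V)}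
    (hs : IsEdgePacking R s) (P : Finset V) (hP : ∀ e ∈ s, ∀ v ∈ e, v ∈ P) :
    2 * s.card ≤ P.card := by
  classical
  have h1 : (s.biUnion Sym2.toFinset).card = ∑ e ∈ s, e.toFinset.card := by
    refine Finset.card_biUnion fun e he e' he' hne => ?_
    rw [Function.onFun, Finset.disjoint_left]
    intro v hv hv'
    exact hne (hs.2 e he e' he' v (by simpa using hv) (by simpa using hv'))
  have h2 : ∑ e ∈ s, e.toFinset.card = ∑ e ∈ s, 2 := Finset.sum_congr rfl fun e he =>
    Sym2.card_toFinset_of_not_isDiag _ (R.not_isDiag_of_mem_edgeSet (hs.1 e he))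
  have h3 : s.biUnion Sym2.toFinset ⊆ P := by
    intro v hv
    obtain ⟨e, he, hve⟩ := Finset.mem_biUnion.1 hv
    exact hP e he v (by simpa using hve)
  have := Finset.card_le_card h3
  rw [h1, h2] at this
  simpa [mul_comm] using this

/-- `R` has all its edges inside `X`, every vertex of `X` lies in a component `K₂` or `C₅`
of `R`, and every matching of `R` has at most `k` edges. -/
structure Realizes {V : Type*} (R : SimpleGraph V) (X : Set V) (k : ℕ) : Prop where
  mem_of_adj : ∀ u v, R.Adj u v → u ∈ X
  piece : ∀ v ∈ X, (∃ f, IsPiece k2 R X f ∧ v ∈ Set.range f) ∨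
    ∃ f, IsPiece cycle5 R X f ∧ v ∈ Set.range f
  card_le : ∀ s, IsEdgePacking R s → s.card ≤ k

lemma IsPiece.sup_map {α β V : Type*} {A : SimpleGraph α} {B : SimpleGraph β} {R : SimpleGraph V}
    {X : Set V} {g : β ↪ V} (hg : IsPiece B R X g) (f : α ↪ V) (hf : ∀ i, f i ∉ X) :
    IsPiece B (R ⊔ A.map f) (X ∪ Set.range f) g := by
  refine ⟨fun i => Or.inl (hg.1 i), fun i x => ?_⟩
  rw [← hg.2, SimpleGraph.sup_adj, or_iff_left]
  rintro ⟨-, a, b, -, h, -⟩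
  exact hf a (h ▸ hg.1 i)

lemma isPiece_sup_map {α V : Type*} (A : SimpleGraph α) {R : SimpleGraph V}
    {X : Set V} (hR : ∀ u v, R.Adj u v → u ∈ X) (f : α ↪ V) (hf : ∀ i, f i ∉ X) :
    IsPiece A (R ⊔ A.map f) (X ∪ Set.range f) f := by
  refine ⟨fun i => Or.inr ⟨i, rfl⟩, fun i x => ?_⟩
  rw [SimpleGraph.sup_adj, or_iff_right (fun h => hf i (hR _ _ h)), SimpleGraph.map_adj]
  constructor
  · rintro ⟨a, b, hab, ha, rfl⟩
    exact ⟨b, f.injective ha ▸ hab, rfl⟩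
  · rintro ⟨j, hj, rfl⟩
    exact ⟨i, j, hj, rfl, rfl⟩

lemma Realizes.sup_map {α V : Type*} [Fintype α] {A : SimpleGraph α} {R : SimpleGraph V}
    {X : Set V} {k c : ℕ} (hR : Realizes R X k) (f : α ↪ V) (hf : ∀ i, f i ∉ X)
    (hA : ∀ v ∈ Set.range f,
      (∃ g, IsPiece k2 (R ⊔ A.map f) (X ∪ Set.range f) g ∧ v ∈ Set.range g) ∨
      ∃ g, IsPiece cycle5 (R ⊔ A.map f) (X ∪ Set.range f) g ∧ v ∈ Set.range g)
    (hc : Fintype.card α ≤ 2 * c + 1) :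
    Realizes (R ⊔ A.map f) (X ∪ Set.range f) (k + c) := by
  classical
  refine ⟨?_, ?_, ?_⟩
  · rintro u v (h | h)
    · exact Or.inl (hR.mem_of_adj _ _ h)
    · obtain ⟨a, b, -, rfl, -⟩ := (SimpleGraph.map_adj ..).1 h
      exact Or.inr ⟨a, rfl⟩
  · rintro v (hv | hv)
    · rcases hR.piece v hv with ⟨g, hg, hvg⟩ | ⟨g, hg, hvg⟩
      · exact Or.inl ⟨g, hg.sup_map f hf, hvg⟩
      · exact Or.inr ⟨g, hg.sup_map f hf, hvg⟩
    · exact hA v hv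
  · intro s hs
    have h1 := hR.card_le (s.filter (· ∈ R.edgeSet))
      ⟨fun e he => (Finset.mem_filter.1 he).2, fun e he e' he' =>
        hs.2 e (Finset.mem_filter.1 he).1 e' (Finset.mem_filter.1 he').1⟩
    have h2 := IsEdgePacking.two_mul_card_le (R := R ⊔ A.map f)
      (s := s.filter (· ∉ R.edgeSet))
      ⟨fun e he => hs.1 e (Finset.mem_filter.1 he).1, fun e he e' he' =>
        hs.2 e (Finset.mem_filter.1 he).1 e' (Finset.mem_filter.1 he').1⟩
      (Finset.univ.map f) (by
        intro e he v hv
        obtain ⟨hes, heR⟩ := Finset.mem_filter.1 he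
        have := hs.1 e hes
        induction e using Sym2.ind with
        | _ x y =>
        rcases this with h | h
        · exact absurd h heR
        · obtain ⟨a, b, -, rfl, rfl⟩ := (SimpleGraph.map_adj ..).1 h
          rcases Sym2.mem_iff.1 hv with rfl | rfl <;> simp)
    have h3 := Finset.card_filter_add_card_filter_not (s := s) (· ∈ R.edgeSet)
    rw [Finset.card_map, Finset.card_univ] at h2
    omega

lemma IsTiled.exists_realizes {V : Type*} {G : SimpleGraph V} {X : Set V} {k : ℕ}
    (h : IsTiled G X k) : ∃ R ≤ G, Realizes R X k := by
  induction h with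
  | empty =>
    refine ⟨⊥, bot_le, by simp, by simp, fun s hs => ?_⟩
    rw [Nat.le_zero, Finset.card_eq_zero, Finset.eq_empty_iff_forall_notMem]
    intro e he
    simpa using hs.1 e he
  | @edge X k h u v huv hu hv ih =>
    obtain ⟨R, hRG, hR⟩ := ih
    let f : Fin 2 ↪ V := ⟨![u, v], by
      intro i j hij
      have := huv.ne
      have := huv.ne'
      fin_cases i <;> fin_cases j <;> simp_all⟩
    have hr : Set.range f = {u, v} := by
      change Set.range ![u, v] = _
      simp [Set.pair_comm]
    have hf : ∀ i, f i ∉ X := by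
      intro i
      fin_cases i <;> simpa [f]
    rw [← hr]
    refine ⟨R ⊔ k2.map f, sup_le hRG ?_, hR.sup_map (c := 1) f hf (fun v hv =>
      Or.inl ⟨f, isPiece_sup_map _ hR.mem_of_adj f hf, hv⟩) (by simp)⟩
    rw [SimpleGraph.map_le_iff_le_comap]
    intro i j hij
    fin_cases i <;> fin_cases j
    exacts [absurd rfl hij.ne, huv, huv.symm, absurd rfl hij.ne]
  | @cycle X k h f hf hX ih =>
    obtain ⟨R, hRG, hR⟩ := ih
    refine ⟨R ⊔ cycle5.map f, sup_le hRG ?_, hR.sup_map (c := 2) f hX (fun v hv =>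
      Or.inr ⟨f, isPiece_sup_map _ hR.mem_of_adj f hX, hv⟩) (by simp [ZMod.card])⟩
    rw [SimpleGraph.map_le_iff_le_comap]
    intro i j hij
    rcases hij with ⟨-, rfl | rfl⟩
    · exact hf i
    · exact (hf j).symm

lemma IsPiece.nonempty_iso {α V : Type*} {A : SimpleGraph α} (hA : A.Preconnected)
    {R : SimpleGraph V} {X : Set V} {f : α ↪ V} (hf : IsPiece A R X f)
    (c : (R.induce X).ConnectedComponent) (i : α)
    (hi : (R.induce X).connectedComponentMk ⟨f i, hf.1 i⟩ = c) :
    Nonempty ((R.induce X).induce c.supp ≃g A) := by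
  have hadj : ∀ i j, R.Adj (f i) (f j) ↔ A.Adj i j := by
    intro i j
    simp [hf.2]
  let φ : A →g R.induce X := ⟨fun j => ⟨f j, hf.1 j⟩, fun {a b} h => (hadj a b).2 h⟩
  have hsurj : ∀ x y : X, (R.induce X).Reachable x y →
      x.1 ∈ Set.range f → y.1 ∈ Set.range f := by
    rintro x y ⟨p⟩ hx
    induction p with
    | nil => exact hx
    | cons h p ih =>
      obtain ⟨j, hj⟩ := hx
      apply ih
      have h' : R.Adj _ _ := h
      change R.Adj (Subtype.val _) (Subtype.val _) at h'
      rw [← hj, hf.2] at h'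
      obtain ⟨l, -, hl⟩ := h'
      exact ⟨l, hl⟩
  have hmem : ∀ j, φ j ∈ c.supp := by
    intro j
    rw [← hi]
    exact ConnectedComponent.sound ((hA j i).map φ)
  refine ⟨RelIso.symm ⟨Equiv.ofBijective (fun j => ⟨φ j, hmem j⟩) ⟨?_, ?_⟩, ?_⟩⟩
  · intro a b hab
    exact f.injective (congrArg (fun x => x.1.1) hab)
  · rintro ⟨x, hx⟩
    obtain ⟨j, hj⟩ := hsurj _ x (ConnectedComponent.exact (hi.trans hx.symm)) ⟨i, rfl⟩
    exact ⟨j, Subtype.ext (Subtype.ext hj)⟩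
  · intro a b
    exact hadj a b

lemma IsTiled.exists_subgraph {V : Type*} [Finite V] {G : SimpleGraph V} {X : Set V} {k : ℕ}
    (h : IsTiled G X k) :
    ∃ H : G.Subgraph, H.verts = X ∧ IsK2C5Graph H.coe ∧ matchNum H.coe ≤ k := by
  classical
  obtain ⟨R, hRG, hR⟩ := h.exists_realizes
  refine ⟨⟨X, R.Adj, fun h => hRG h, fun h => hR.mem_of_adj _ _ h, R.symm⟩, rfl, ?_, ?_⟩
  · change IsK2C5Graph (R.induce X)
    intro c
    induction c using ConnectedComponent.ind with
    | _ x =>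
    obtain ⟨x, hx⟩ := x
    rcases hR.piece x hx with ⟨f, hf, i, rfl⟩ | ⟨f, hf, i, rfl⟩
    · exact Or.inl (hf.nonempty_iso k2_connected _ i rfl)
    · exact Or.inr (hf.nonempty_iso cycle5_connected _ i rfl)
  · change matchNum (R.induce X) ≤ k
    refine csSup_le' ?_
    rintro _ ⟨M, hM, rfl⟩
    have hinj : Function.Injective (Sym2.map (Subtype.val : X → V)) :=
      Sym2.map.injective Subtype.val_injective
    have hfin : (Sym2.map (Subtype.val : X → V) '' M.edgeSet).Finite := Set.toFinite _
    rw [← Set.ncard_image_of_injective _ hinj, Set.ncard_eq_toFinset_card _ hfin]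
    refine hR.card_le _ ⟨?_, ?_⟩
    · intro e hs
      obtain ⟨e, he, rfl⟩ := hfin.mem_toFinset.1 hs
      induction e using Sym2.ind with
      | _ x y => exact M.adj_sub he
    · intro e hs e' hs' v hv hv'
      obtain ⟨e, he, rfl⟩ := hfin.mem_toFinset.1 hs
      obtain ⟨e', he', rfl⟩ := hfin.mem_toFinset.1 hs'
      obtain ⟨a, ha, rfl⟩ := Sym2.mem_map.1 hv
      obtain ⟨b, hb, hab⟩ := Sym2.mem_map.1 hv'
      obtain rfl := Subtype.ext hab
      obtain ⟨y, rfl⟩ := ha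
      obtain ⟨z, rfl⟩ := hb
      have hyz : y = z := (hM (M.edge_vert he)).unique he he'
      rw [hyz]

/-- Outside `S`, the set `X` is covered by a tiling inside `X \ S` and by single vertices,
of total cost at most `k`. -/
def IsCoveredOff {V : Type*} (G : SimpleGraph V) (S X : Set V) (k : ℕ) : Prop :=
  ∃ (Y : Set V) (T : Finset V) (l : ℕ), IsTiled G Y l ∧ Y ⊆ X ∧ Disjoint Y S ∧
    X \ S ⊆ Y ∪ T ∧ l + T.card ≤ k

lemma IsCoveredOff.mono {V : Type*} {G : SimpleGraph V} {S X X' : Set V} {k k' : ℕ}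
    (h : IsCoveredOff G S X k) (hX : X ⊆ X') (hX' : X' \ S ⊆ X) (hk : k ≤ k') :
    IsCoveredOff G S X' k' := by
  obtain ⟨Y, T, l, hY, hYX, hYS, hc, hl⟩ := h
  exact ⟨Y, T, l, hY, hYX.trans hX, hYS, fun x hx => hc ⟨hX' hx, hx.2⟩, hl.trans hk⟩

lemma IsCoveredOff.insert {V : Type*} {G : SimpleGraph V} {S X : Set V} {k : ℕ}
    (h : IsCoveredOff G S X k) (x : V) : IsCoveredOff G S (insert x X) (k + 1) := by
  classical
  obtain ⟨Y, T, l, hY, hYX, hYS, hc, hl⟩ := h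
  refine ⟨Y, Insert.insert x T, l, hY, hYX.trans (Set.subset_insert _ _), hYS, ?_, ?_⟩
  · rintro y ⟨rfl | hy, hyS⟩
    · simp
    · rcases hc ⟨hy, hyS⟩ with h | h
      · exact Or.inl h
      · simp_all
  · have := Finset.card_insert_le x T
    omega

lemma IsCoveredOff.edge {V : Type*} {G : SimpleGraph V} {S X : Set V} {k : ℕ}
    (h : IsCoveredOff G S X k) {u v : V} (huv : G.Adj u v) (hu : u ∉ X) (hv : v ∉ X) :
    IsCoveredOff G S (X ∪ {u, v}) (k + 1) := by
  by_cases huS : u ∈ S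
  · refine (h.insert v).mono ?_ ?_ le_rfl
    · rintro x (rfl | hx) <;> simp_all
    · rintro x ⟨hx | rfl | rfl, hxS⟩ <;> simp_all
  by_cases hvS : v ∈ S
  · refine (h.insert u).mono ?_ ?_ le_rfl
    · rintro x (rfl | hx) <;> simp_all
    · rintro x ⟨hx | rfl | rfl, hxS⟩ <;> simp_all
  obtain ⟨Y, T, l, hY, hYX, hYS, hc, hl⟩ := h
  refine ⟨Y ∪ {u, v}, T, l + 1, hY.edge huv (fun h => hu (hYX h)) (fun h => hv (hYX h)),
    Set.union_subset_union_left _ hYX, ?_, ?_, by omega⟩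
  · rw [Set.disjoint_union_left]
    refine ⟨hYS, Set.disjoint_left.2 ?_⟩
    rintro x (rfl | rfl) <;> assumption
  · rintro x ⟨hx | hx, hxS⟩
    · rcases hc ⟨hx, hxS⟩ with h | h
      · exact Or.inl (Or.inl h)
      · exact Or.inr h
    · exact Or.inl (Or.inr hx)

lemma IsCoveredOff.cycle {V : Type*} {G : SimpleGraph V} {S X : Set V} {k : ℕ}
    (h : IsCoveredOff G S X k) (f : ZMod 5 ↪ V) (hf : ∀ i, G.Adj (f i) (f (i + 1)))
    (hX : ∀ i, f i ∉ X) : IsCoveredOff G S (X ∪ Set.range f) (k + 2) := by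
  by_cases hS : ∃ i, f i ∈ S
  · obtain ⟨i, hi⟩ := hS
    have h2 := (h.edge (hf (i + 1)) (hX _) (hX _)).edge (hf (i + 3))
      (by simp [hX, add_assoc]; decide) (by simp [hX, add_assoc]; decide)
    refine h2.mono ?_ ?_ le_rfl
    · rintro x ((hx | rfl | rfl) | rfl | rfl) <;> simp_all
    · rintro x ⟨hx | ⟨j, rfl⟩, hxS⟩
      · simp [hx]
      · obtain ⟨d, rfl⟩ : ∃ d, j = i + d := ⟨j - i, by ring⟩
        have hd : d ≠ 0 := by rintro rfl; simp_all
        have : d = 1 ∨ d = 1 + 1 ∨ d = 3 ∨ d = 3 + 1 := by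
          clear hxS
          revert d; decide
        rcases this with rfl | rfl | rfl | rfl <;> simp [add_assoc]
  · push Not at hS
    obtain ⟨Y, T, l, hY, hYX, hYS, hc, hl⟩ := h
    refine ⟨Y ∪ Set.range f, T, l + 2, hY.cycle f hf (fun i h => hX i (hYX h)),
      Set.union_subset_union_left _ hYX, ?_, ?_, by omega⟩
    · rw [Set.disjoint_union_left]
      refine ⟨hYS, Set.disjoint_left.2 ?_⟩
      rintro _ ⟨i, rfl⟩
      exact hS i
    · rintro x ⟨hx | hx, hxS⟩
      · rcases hc ⟨hx, hxS⟩ with h | h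
        · exact Or.inl (Or.inl h)
        · exact Or.inr h
      · exact Or.inl (Or.inr hx)

lemma IsTiled.isCoveredOff {V : Type*} {G : SimpleGraph V} (S : Set V) {X : Set V} {k : ℕ}
    (h : IsTiled G X k) : IsCoveredOff G S X k := by
  induction h with
  | empty => exact ⟨∅, ∅, 0, .empty, by simp, by simp, by simp, by simp⟩
  | edge h huv hu hv ih => exact ih.edge huv hu hv
  | cycle h f hf hX ih => exact ih.cycle f hf hX

lemma IsTiled.exists_isCoveredOff_closedNbhd {V : Type*} {G : SimpleGraph V} {w : V} {X : Set V}
    {k : ℕ} (h : IsTiled G X k) (hw : w ∈ X) :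
    ∃ l, l + 1 ≤ k ∧ IsCoveredOff G (closedNbhd G w) X l := by
  have hself : w ∈ closedNbhd G w := Set.mem_insert _ _
  have hnbr : ∀ x, G.Adj w x → x ∈ closedNbhd G w := fun x hx => Set.mem_insert_of_mem _ hx
  induction h with
  | empty => simp at hw
  | @edge X k h u v huv hu hv ih =>
    rcases hw with hw | hw
    · obtain ⟨l, hl, hc⟩ := ih hw
      exact ⟨l + 1, by omega, hc.edge huv hu hv⟩
    · refine ⟨k, le_rfl, (h.isCoveredOff _).mono Set.subset_union_left ?_ le_rfl⟩
      rintro x ⟨hx | hx, hxS⟩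
      · exact hx
      · have := huv.symm
        rcases hw with rfl | rfl <;> rcases hx with rfl | rfl <;> simp_all
  | @cycle X k h f hf hX ih =>
    rcases hw with hw | ⟨i, rfl⟩
    · obtain ⟨l, hl, hc⟩ := ih hw
      exact ⟨l + 2, by omega, hc.cycle f hf hX⟩
    · refine ⟨k + 1, le_rfl, ((h.isCoveredOff _).edge (hf (i + 2)) (hX _) (hX _)).mono
        ?_ ?_ le_rfl⟩
      · rintro x (hx | rfl | rfl) <;> simp_all
      · rintro x ⟨hx | ⟨j, rfl⟩, hxS⟩
        · simp [hx]
        · obtain ⟨d, rfl⟩ : ∃ d, j = i + d := ⟨j - i, by ring⟩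
          have h0 : d ≠ 0 := by rintro rfl; simp_all
          have h1 : d ≠ 1 := by rintro rfl; exact hxS (hnbr _ (hf i))
          have h4 : d ≠ 4 := by
            rintro rfl
            refine hxS (hnbr _ ?_)
            have := (hf (i + 4)).symm
            rwa [add_assoc, show (4 + 1 : ZMod 5) = 0 by decide, add_zero] at this
          have : d = 2 ∨ d = 2 + 1 := by
            clear hxS
            revert d; decide
          rcases this with rfl | rfl <;> simp [add_assoc]

lemma IsTiled.exists_extend {V : Type*} {G : SimpleGraph V} (S : Set V) (T : Finset V) :
    ∀ {Y : Set V} {k : ℕ}, IsTiled G Y k → Disjoint Y S →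
      (∀ u v, G.Adj u v → u ∈ S ∪ Y ∪ T ∨ v ∈ S ∪ Y ∪ T) →
      ∃ Y' k', IsTiled G Y' k' ∧ k' ≤ k + T.card ∧ Disjoint Y' S ∧
        ∀ u v, G.Adj u v → u ∈ S ∪ Y' ∨ v ∈ S ∪ Y' := by
  classical
  induction T using Finset.induction_on with
  | empty =>
    intro Y k hY hYS hc
    exact ⟨Y, k, hY, by simp, hYS, by simpa using hc⟩
  | insert x T hx ih =>
    intro Y k hY hYS hc
    rw [Finset.card_insert_of_notMem hx]
    by_cases hxz : x ∉ S ∪ Y ∧ ∃ z, G.Adj x z ∧ z ∉ S ∪ Y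
    · obtain ⟨hxn, z, hz, hzn⟩ := hxz
      simp only [Set.mem_union, not_or] at hxn hzn
      obtain ⟨Y', k', h1, h2, h3, h4⟩ := ih (hY.edge hz hxn.2 hzn.2) (by
        rw [Set.disjoint_union_left]
        refine ⟨hYS, Set.disjoint_left.2 ?_⟩
        rintro y (rfl | rfl)
        · exact hxn.1
        · exact hzn.1) (by
        intro u v huv
        have := hc u v huv
        simp only [Set.mem_union, Finset.coe_insert, Set.mem_insert_iff,
          Set.mem_singleton_iff, Finset.mem_coe] at this ⊢
        tauto)
      exact ⟨Y', k', h1, by omega, h3, h4⟩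
    · obtain ⟨Y', k', h1, h2, h3, h4⟩ := ih hY hYS (by
        intro u v huv
        have hcuv := hc u v huv
        push Not at hxz
        simp only [Set.mem_union, Finset.coe_insert, Set.mem_insert_iff,
          Finset.mem_coe] at hcuv hxz ⊢
        by_cases hux : u = x
        · subst hux
          have := fun h => hxz h v huv
          tauto
        by_cases hvx : v = x
        · subst hvx
          have := fun h => hxz h u huv.symm
          tauto
        tauto)
      exact ⟨Y', k', h1, by omega, h3, h4⟩

lemma exists_isMaximalK2C5Subgraph {V : Type*} [Finite V] (G : SimpleGraph V) :
    ∃ H : G.Subgraph, IsMaximalK2C5Subgraph G H := by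
  have := Fintype.ofFinite V
  obtain ⟨Y, k, hY, -, -, hc⟩ := IsTiled.exists_extend (G := G) ∅ Finset.univ .empty
    (by simp) (by simp)
  obtain ⟨H, rfl, hH, -⟩ := hY.exists_subgraph
  exact ⟨H, hH, by simpa using hc⟩

/-- For every finite simple graph `G` with at least one edge, there exists a vertex `w`
such that `min-match_{K₂,C₅}(G - N_G[w]) ≤ min-match_{K₂,C₅}(G) - 1`. -/
theorem stmt2 {V : Type*} [Fintype V] (G : SimpleGraph V) (hE : G.edgeSet.Nonempty) :
    ∃ w : V, minMatchK2C5 (delClosedNbhd G w) + 1 ≤ minMatchK2C5 G := by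
  obtain ⟨H₀, hH₀⟩ := exists_isMaximalK2C5Subgraph G
  obtain ⟨H, hH, hHk⟩ : minMatchK2C5 G ∈
      { k | ∃ H : G.Subgraph, IsMaximalK2C5Subgraph G H ∧ matchNum H.coe = k } :=
    Nat.sInf_mem ⟨_, H₀, hH₀, rfl⟩
  obtain ⟨k, hk⟩ := hH.1.exists_isTiled
  have hkm : k ≤ matchNum H.coe := hk.le_matchNum
  have hT : IsTiled G H.verts k := by
    simpa using hk.map (Function.Embedding.subtype _) (fun u v h => H.adj_sub h)
  obtain ⟨w, hw⟩ : H.verts.Nonempty := by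
    obtain ⟨e, he⟩ := hE
    induction e using Sym2.ind with
    | _ u v => exact (hH.2 he).elim (fun h => ⟨u, h⟩) (fun h => ⟨v, h⟩)
  obtain ⟨l, hl, Y, T, m, hY, -, hYS, hc, hm⟩ := hT.exists_isCoveredOff_closedNbhd hw
  have hcov : ∀ x ∈ H.verts, x ∈ closedNbhd G w ∪ Y ∪ T := by
    intro x hx
    by_cases hxS : x ∈ closedNbhd G w
    · exact Or.inl (Or.inl hxS)
    · rw [Set.union_assoc]
      exact Or.inr (hc ⟨hx, hxS⟩)
  obtain ⟨Y', k', hY', hk', hYS', hc'⟩ := hY.exists_extend _ T hYS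
    (fun u v huv => (hH.2 huv).imp (hcov u) (hcov v))
  obtain ⟨H', hv', hH', hm'⟩ := (hY'.induce (closedNbhd G w)ᶜ
    (Set.subset_compl_iff_disjoint_right.2 hYS')).exists_subgraph
  refine ⟨w, ?_⟩
  have : minMatchK2C5 (delClosedNbhd G w) ≤ matchNum H'.coe := by
    refine Nat.sInf_le ⟨H', ⟨hH', ?_⟩, rfl⟩
    rintro ⟨u, hu⟩ ⟨v, hv⟩ huv
    rw [hv']
    exact (hc' u v huv).imp (fun h => h.resolve_left hu) (fun h => h.resolve_left hv)
  omega

end Paper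
end

section
/- For every finite simple graph G and every integer s ≥ 1, the Castelnuovo–Mumford regularity of the s-th power of the edge ideal satisfies reg(I(G)^s) ≤ 2s + cochord(G) − 1, where cochord(G) is the co-chordal cover number of G. -/
open SimpleGraph

namespace Paper

/-- The edge ideal of a graph `G`, in the polynomial ring over `K` with variables
indexed by the vertices of `G`. -/
noncomputable def edgeIdeal (K : Type) [Field K] {V : Type} (G : SimpleGraph V) :
    Ideal (MvPolynomial V K) :=
  Ideal.span { m | ∃ u v : V, G.Adj u v ∧ m = MvPolynomial.X u * MvPolynomial.X v }

/-- `HasResolutionDegreeBound K I r` says that the ideal `I` admits a graded free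
resolution `⋯ → F₁ → F₀ → I → 0`, where `Fᵢ = ⊕_k S(-d i k)` is a graded free module
whose generators sit in degrees `d i k ≤ i + r`.  The maps are required to be graded
(degree-preserving) and the sequence exact.  By the standard characterization via the
minimal graded free resolution, the Castelnuovo–Mumford regularity of `I` is the least
`r` for which such a resolution exists. -/
def HasResolutionDegreeBound (K : Type) [Field K] {V : Type}
    (I : Ideal (MvPolynomial V K)) (r : ℕ) : Prop :=
  ∃ (m : ℕ → ℕ) (d : (i : ℕ) → Fin (m i) → ℕ)
    (f : (i : ℕ) → ((Fin (m (i + 1)) → MvPolynomial V K) →ₗ[MvPolynomial V K]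
        (Fin (m i) → MvPolynomial V K)))
    (ε : (Fin (m 0) → MvPolynomial V K) →ₗ[MvPolynomial V K] MvPolynomial V K),
    -- the augmentation map is graded: the image of the `k`-th basis vector is
    -- homogeneous of degree `d 0 k`
    (∀ k, MvPolynomial.IsHomogeneous (ε (Pi.single k 1)) (d 0 k)) ∧
    -- the differentials are graded maps of degree zero
    (∀ i k l, MvPolynomial.IsHomogeneous (f i (Pi.single k 1) l) (d (i + 1) k - d i l) ∧
        (d (i + 1) k < d i l → f i (Pi.single k 1) l = 0)) ∧
    -- exactness: `F₀` surjects onto `I`, and the complex is exact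
    LinearMap.range ε = I ∧
    LinearMap.range (f 0) = LinearMap.ker ε ∧
    (∀ i, LinearMap.range (f (i + 1)) = LinearMap.ker (f i)) ∧
    -- the degree bound on the twists
    (∀ i k, d i k ≤ i + r)

/-- The Castelnuovo–Mumford regularity of an ideal in a polynomial ring:
the least `r` such that `I` has a graded free resolution whose `i`-th free module is
generated in degrees `≤ i + r`. -/
noncomputable def reg (K : Type) [Field K] {V : Type} (I : Ideal (MvPolynomial V K)) : ℕ :=
  sInf { r | HasResolutionDegreeBound K I r }

section GradedModules

variable {K : Type} [Field K] {V : Type}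

/-- A module over a polynomial ring together with a compatible family of graded pieces. -/
structure GradedMod (K : Type) [Field K] (V : Type) where
  /-- the underlying type -/
  carrier : Type
  [addCommGroup : AddCommGroup carrier]
  [module : Module (MvPolynomial V K) carrier]
  /-- the homogeneous elements of a given degree -/
  piece : ℕ → AddSubgroup carrier
  smul_mem : ∀ (D : ℕ) (μ : V →₀ ℕ) (c : K) (m : carrier), m ∈ piece D →
    MvPolynomial.monomial μ c • m ∈ piece (μ.degree + D)

attribute [instance] GradedMod.addCommGroup GradedMod.module

instance : CoeSort (GradedMod K V) Type := ⟨GradedMod.carrier⟩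

/-- The homogeneous elements of degree `D` of the graded free module with generators in
degrees `d k`. -/
def freePiece (K : Type) [Field K] (V : Type) {n : ℕ} (d : Fin n → ℕ) (D : ℕ) :
    AddSubgroup (Fin n → MvPolynomial V K) where
  carrier := {s | ∀ k, ∀ μ, (s k).coeff μ ≠ 0 → μ.degree + d k = D}
  zero_mem' := by simp
  add_mem' := by
    intro a b ha hb k μ h
    by_contra hne
    have h1 : (a k).coeff μ = 0 := by_contra fun h' => hne (ha k μ h')
    have h2 : (b k).coeff μ = 0 := by_contra fun h' => hne (hb k μ h')
    exact h (by simp [h1, h2])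
  neg_mem' := by
    intro a ha k μ h
    exact ha k μ (by simpa using h)

theorem mem_freePiece {n : ℕ} {d : Fin n → ℕ} {D : ℕ} {s : Fin n → MvPolynomial V K} :
    s ∈ freePiece K V d D ↔ ∀ k, ∀ μ, (s k).coeff μ ≠ 0 → μ.degree + d k = D := Iff.rfl

theorem coeff_monomial_mul_ne_zero {μ ν : V →₀ ℕ} {c : K} {p : MvPolynomial V K}
    (h : (MvPolynomial.monomial μ c * p).coeff ν ≠ 0) :
    ∃ ρ, ν = μ + ρ ∧ p.coeff ρ ≠ 0 := by
  classical
  rw [MvPolynomial.coeff_monomial_mul'] at h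
  split_ifs at h with hle
  · refine ⟨ν - μ, (add_tsub_cancel_of_le hle).symm, fun h0 => h (by simp [h0])⟩
  · exact absurd rfl h

theorem smul_mem_freePiece {n : ℕ} {d : Fin n → ℕ} {D : ℕ} {s : Fin n → MvPolynomial V K}
    (hs : s ∈ freePiece K V d D) (μ : V →₀ ℕ) (c : K) :
    MvPolynomial.monomial μ c • s ∈ freePiece K V d (μ.degree + D) := by
  intro k ν h
  obtain ⟨ρ, rfl, hρ⟩ := coeff_monomial_mul_ne_zero (by simpa using h)
  rw [map_add, add_assoc, hs k ρ hρ]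

/-- A submodule of a graded free module, with the induced grading. -/
noncomputable def gradedSub {n : ℕ} (d : Fin n → ℕ)
    (N : Submodule (MvPolynomial V K) (Fin n → MvPolynomial V K)) :
    GradedMod K V where
  carrier := N
  piece D := (freePiece K V d D).comap N.subtype.toAddMonoidHom
  smul_mem _ μ c _ hm := smul_mem_freePiece hm μ c

theorem mem_gradedSub_piece {n : ℕ} {d : Fin n → ℕ}
    {N : Submodule (MvPolynomial V K) (Fin n → MvPolynomial V K)} {D : ℕ} {x : N} :
    (show (gradedSub d N) from x) ∈ (gradedSub d N).piece D ↔
      (x : Fin n → MvPolynomial V K) ∈ freePiece K V d D := Iff.rfl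

/-- A graded surjection onto `M` from a graded free module generated in degrees at most `r`,
whose kernel satisfies `P` for the bound `r + 1`. -/
def SyzygyStep (P : GradedMod K V → ℕ → Prop) (M : GradedMod K V) (r : ℕ) : Prop :=
  ∃ (n : ℕ) (d : Fin n → ℕ) (ε : (Fin n → MvPolynomial V K) →ₗ[MvPolynomial V K] M),
    (∀ k, d k ≤ r) ∧ (∀ D, ∀ s ∈ freePiece K V d D, ε s ∈ M.piece D) ∧
    Function.Surjective ε ∧ (∀ D, ∀ m ∈ M.piece D, ∃ s ∈ freePiece K V d D, ε s = m) ∧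
    P (gradedSub d (LinearMap.ker ε)) (r + 1)

/-- `M` is `r`-regular: one can form syzygies forever, the `i`-th ones being generated in
degrees at most `i + r`. -/
def IsRegular (M : GradedMod K V) (r : ℕ) : Prop :=
  ∃ P : GradedMod K V → ℕ → Prop, (∀ M r, P M r → SyzygyStep P M r) ∧ P M r

theorem SyzygyStep.mono {P Q : GradedMod K V → ℕ → Prop} (h : ∀ M r, P M r → Q M r)
    {M : GradedMod K V} {r : ℕ} (hM : SyzygyStep P M r) : SyzygyStep Q M r := by
  obtain ⟨n, d, ε, h1, h2, h3, h4, h5⟩ := hM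
  exact ⟨n, d, ε, h1, h2, h3, h4, h _ _ h5⟩

theorem IsRegular.step {M : GradedMod K V} {r : ℕ} (h : IsRegular M r) :
    SyzygyStep IsRegular M r := by
  obtain ⟨P, hP, hM⟩ := h
  exact (hP M r hM).mono fun N s hN => ⟨P, hP, hN⟩

theorem SyzygyStep.isRegular {M : GradedMod K V} {r : ℕ} (h : SyzygyStep IsRegular M r) :
    IsRegular M r := by
  refine ⟨SyzygyStep IsRegular, fun N s hN => hN.mono fun _ _ h => h.step, h⟩

/-- A short exact sequence of graded modules, exact in each degree. -/
structure GradedShortExact (A B C : GradedMod K V) where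
  /-- the injection -/
  i : A →ₗ[MvPolynomial V K] B
  /-- the projection -/
  p : B →ₗ[MvPolynomial V K] C
  inj : Function.Injective i
  comp_eq_zero : ∀ a, p (i a) = 0
  exact : ∀ b, p b = 0 → ∃ a, i a = b
  surj : Function.Surjective p
  mem_piece_iff : ∀ D a, i a ∈ B.piece D ↔ a ∈ A.piece D
  map_piece : ∀ D, ∀ b ∈ B.piece D, p b ∈ C.piece D
  surj_piece : ∀ D, ∀ c ∈ C.piece D, ∃ b ∈ B.piece D, p b = c

theorem sum_smul_mem_piece (M : GradedMod K V) {n : ℕ} {d : Fin n → ℕ} {b : Fin n → M}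
    (hb : ∀ k, b k ∈ M.piece (d k)) {D : ℕ} {s : Fin n → MvPolynomial V K}
    (hs : s ∈ freePiece K V d D) : ∑ k, s k • b k ∈ M.piece D := by
  refine AddSubgroup.sum_mem _ fun k _ => ?_
  rw [(s k).as_sum, Finset.sum_smul]
  refine AddSubgroup.sum_mem _ fun μ hμ => ?_
  have := M.smul_mem _ μ ((s k).coeff μ) _ (hb k)
  rwa [hs k μ (MvPolynomial.mem_support_iff.1 hμ)] at this

theorem single_mem_freePiece {n : ℕ} (d : Fin n → ℕ) (k : Fin n) :
    (Pi.single k 1 : Fin n → MvPolynomial V K) ∈ freePiece K V d (d k) := by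
  classical
  intro l μ h
  by_cases hl : l = k
  · subst hl
    rw [Pi.single_eq_same, MvPolynomial.coeff_one] at h
    have : μ = 0 := by by_contra h'; exact h (by simp [Ne.symm h'])
    simp [this]
  · simp [Pi.single_eq_of_ne hl] at h

section Append

variable {n m : ℕ}

theorem append_mem_freePiece {d : Fin n → ℕ} {e : Fin m → ℕ} {D : ℕ}
    {s : Fin n → MvPolynomial V K} {t : Fin m → MvPolynomial V K} :
    Fin.append s t ∈ freePiece K V (Fin.append d e) D ↔
      s ∈ freePiece K V d D ∧ t ∈ freePiece K V e D := by
  simp only [mem_freePiece]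
  constructor
  · intro h
    exact ⟨fun k => by simpa using h (Fin.castAdd m k), fun k => by simpa using h (Fin.natAdd n k)⟩
  · rintro ⟨h1, h2⟩ k
    induction k using Fin.addCases with
    | left k => simpa using h1 k
    | right k => simpa using h2 k

theorem append_funLeft {S : Type} [CommRing S] (s : Fin (n + m) → S) :
    Fin.append (LinearMap.funLeft S S (Fin.castAdd m) s)
      (LinearMap.funLeft S S (Fin.natAdd n) s) = s := by
  ext k
  induction k using Fin.addCases <;> simp [LinearMap.funLeft_apply]

theorem funLeft_castAdd_append {S : Type} [CommRing S] (s : Fin n → S) (t : Fin m → S) :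
    LinearMap.funLeft S S (Fin.castAdd m) (Fin.append s t) = s := by
  ext k; simp [LinearMap.funLeft_apply]

theorem funLeft_natAdd_append {S : Type} [CommRing S] (s : Fin n → S) (t : Fin m → S) :
    LinearMap.funLeft S S (Fin.natAdd n) (Fin.append s t) = t := by
  ext k; simp [LinearMap.funLeft_apply]

end Append

/-- The horseshoe lemma: an extension of `r`-regular modules is `r`-regular. -/
theorem GradedShortExact.isRegular_middle {A B C : GradedMod K V} {r : ℕ}
    (h : GradedShortExact A B C) (hA : IsRegular A r) (hC : IsRegular C r) : IsRegular B r := by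
  refine ⟨fun B r => ∃ A C, Nonempty (GradedShortExact A B C) ∧ IsRegular A r ∧ IsRegular C r,
    ?_, A, C, ⟨h⟩, hA, hC⟩
  clear hA hC h A B C r
  rintro B r ⟨A, C, ⟨h⟩, hA, hC⟩
  obtain ⟨n, d, α, hd, hα, hαs, hαp, hA'⟩ := hA.step
  obtain ⟨m, e, γ, he, hγ, hγs, hγp, hC'⟩ := hC.step
  choose b hb hpb using fun k => h.surj_piece _ _ (hγ _ _ (single_mem_freePiece e k))
  set L : (Fin m → MvPolynomial V K) →ₗ[MvPolynomial V K] B :=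
    Fintype.linearCombination (MvPolynomial V K) b with hL
  have hLp : ∀ t, h.p (L t) = γ t := by
    intro t
    conv_rhs => rw [pi_eq_sum_univ' t]
    simp only [hL, Fintype.linearCombination_apply, map_sum, map_smul, hpb]
  have hLD : ∀ D, ∀ t ∈ freePiece K V e D, L t ∈ B.piece D := fun D t ht =>
    sum_smul_mem_piece B hb ht
  set ε : (Fin (n + m) → MvPolynomial V K) →ₗ[MvPolynomial V K] B :=
    h.i ∘ₗ α ∘ₗ LinearMap.funLeft _ _ (Fin.castAdd m) +
      L ∘ₗ LinearMap.funLeft _ _ (Fin.natAdd n) with hε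
  have happ : ∀ s t, ε (Fin.append s t) = h.i (α s) + L t := by
    intro s t
    simp only [hε, LinearMap.add_apply, LinearMap.comp_apply, funLeft_castAdd_append,
      funLeft_natAdd_append]
  have hsplit : ∀ u : Fin (n + m) → MvPolynomial V K, ∃ s t, u = Fin.append s t := fun u =>
    ⟨_, _, (append_funLeft u).symm⟩
  refine ⟨n + m, Fin.append d e, ε, ?_, ?_, ?_, ?_, ?_⟩
  · intro k
    induction k using Fin.addCases with
    | left k => simpa using hd k
    | right k => simpa using he k
  · intro D u hu
    obtain ⟨s, t, rfl⟩ := hsplit u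
    rw [append_mem_freePiece] at hu
    rw [happ]
    exact add_mem ((h.mem_piece_iff _ _).2 (hα _ _ hu.1)) (hLD _ _ hu.2)
  · intro x
    obtain ⟨t, ht⟩ := hγs (h.p x)
    obtain ⟨a, ha⟩ := h.exact (x - L t) (by rw [map_sub, hLp, ht, sub_self])
    obtain ⟨s, rfl⟩ := hαs a
    exact ⟨Fin.append s t, by rw [happ, ha]; abel⟩
  · intro D x hx
    obtain ⟨t, htD, ht⟩ := hγp D (h.p x) (h.map_piece _ _ hx)
    obtain ⟨a, ha⟩ := h.exact (x - L t) (by rw [map_sub, hLp, ht, sub_self])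
    have haD : a ∈ A.piece D := by
      rw [← h.mem_piece_iff, ha]
      exact sub_mem hx (hLD _ _ htD)
    obtain ⟨s, hsD, rfl⟩ := hαp D a haD
    exact ⟨Fin.append s t, append_mem_freePiece.2 ⟨hsD, htD⟩, by rw [happ, ha]; abel⟩
  · refine ⟨_, _, ⟨?_⟩, hA', hC'⟩
    have hker : ∀ s : LinearMap.ker α, Fin.append (s : Fin n → MvPolynomial V K) 0 ∈
        LinearMap.ker ε := by
      intro s
      rw [LinearMap.mem_ker, happ, LinearMap.mem_ker.1 s.2, map_zero, map_zero, add_zero]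
    refine
      { i := ({ toFun := fun s : LinearMap.ker α => (⟨Fin.append s.1 0, hker s⟩ : LinearMap.ker ε)
                map_add' := ?_
                map_smul' := ?_ } : LinearMap.ker α →ₗ[MvPolynomial V K] LinearMap.ker ε)
        p := ((LinearMap.funLeft _ _ (Fin.natAdd n)).restrict (p := LinearMap.ker ε)
          (q := LinearMap.ker γ) ?_ : LinearMap.ker ε →ₗ[MvPolynomial V K] LinearMap.ker γ)
        inj := ?_
        comp_eq_zero := ?_
        exact := ?_
        surj := ?_
        mem_piece_iff := ?_
        map_piece := ?_
        surj_piece := ?_ }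
    · intro s t
      ext k : 2
      induction k using Fin.addCases <;> simp
    · intro c s
      ext k : 2
      induction k using Fin.addCases <;> simp
    · intro u hu
      obtain ⟨s, t, rfl⟩ := hsplit u
      rw [LinearMap.mem_ker, happ] at hu
      rw [funLeft_natAdd_append, LinearMap.mem_ker, ← hLp]
      have := congrArg h.p hu
      rwa [map_add, h.comp_eq_zero, zero_add, map_zero] at this
    · intro s t hst
      have := congrArg (fun u : LinearMap.ker ε =>
        LinearMap.funLeft (MvPolynomial V K) (MvPolynomial V K) (Fin.castAdd m) u.1) hst
      exact Subtype.ext ((funLeft_castAdd_append _ _).symm.trans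
        (this.trans (funLeft_castAdd_append _ _)))
    · intro s
      exact Subtype.ext (funLeft_natAdd_append _ _)
    · rintro ⟨u, hu⟩ hpu
      obtain ⟨s, t, rfl⟩ := hsplit u
      have ht : t = 0 := by
        have : LinearMap.funLeft (MvPolynomial V K) (MvPolynomial V K) (Fin.natAdd n)
            (Fin.append s t) = 0 :=
          congrArg Subtype.val hpu
        rwa [funLeft_natAdd_append] at this
      subst ht
      rw [LinearMap.mem_ker, happ, map_zero, add_zero] at hu
      exact ⟨⟨s, h.inj (hu.trans (map_zero _).symm)⟩, rfl⟩
    · rintro ⟨t, ht⟩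
      obtain ⟨a, ha⟩ := h.exact (L t) (by rw [hLp]; exact ht)
      obtain ⟨s, rfl⟩ := hαs a
      refine ⟨⟨Fin.append (-s) t, ?_⟩, Subtype.ext (funLeft_natAdd_append _ _)⟩
      rw [LinearMap.mem_ker, happ, map_neg, map_neg, ha, neg_add_cancel]
    · intro D s
      change Fin.append s.1 0 ∈ freePiece K V _ D ↔ s.1 ∈ freePiece K V _ D
      rw [append_mem_freePiece]
      exact and_iff_left (zero_mem _)
    · rintro D ⟨u, hu⟩ huD
      obtain ⟨s, t, rfl⟩ := hsplit u
      have h1 := (append_mem_freePiece.1 (mem_gradedSub_piece.1 huD)).2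
      rw [← funLeft_natAdd_append s t] at h1
      exact h1
    · rintro D ⟨t, ht⟩ htD
      obtain ⟨a, ha⟩ := h.exact (L t) (by rw [hLp]; exact ht)
      have haD : a ∈ A.piece D := by
        rw [← h.mem_piece_iff, ha]
        exact hLD _ _ htD
      obtain ⟨s, hsD, rfl⟩ := hαp D a haD
      refine ⟨⟨Fin.append (-s) t, ?_⟩, append_mem_freePiece.2 ⟨neg_mem hsD, htD⟩,
        Subtype.ext (funLeft_natAdd_append _ _)⟩
      rw [LinearMap.mem_ker, happ, map_neg, map_neg, ha, neg_add_cancel]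

theorem GradedShortExact.isRegular_right {A B C : GradedMod K V} {r : ℕ}
    (h : GradedShortExact A B C) (hA : IsRegular A (r + 1)) (hB : IsRegular B r) :
    IsRegular C r := by
  obtain ⟨n, d, ε, hd, hε, hεs, hεp, hK⟩ := hB.step
  refine SyzygyStep.isRegular ⟨n, d, h.p ∘ₗ ε, hd, fun D s hs => h.map_piece _ _ (hε _ _ hs),
    h.surj.comp hεs, ?_, ?_⟩
  · intro D c hc
    obtain ⟨b, hb, rfl⟩ := h.surj_piece _ _ hc
    obtain ⟨s, hs, rfl⟩ := hεp _ _ hb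
    exact ⟨s, hs, rfl⟩
  have hq : ∀ s : LinearMap.ker (h.p ∘ₗ ε), ∃ a, h.i a = ε s := fun s => h.exact _ s.2
  choose q hq using hq
  refine GradedShortExact.isRegular_middle (A := gradedSub d (LinearMap.ker ε)) (C := A) ?_ hK hA
  refine
    { i := (Submodule.inclusion (LinearMap.ker_le_ker_comp ε h.p) :
        LinearMap.ker ε →ₗ[MvPolynomial V K] LinearMap.ker (h.p ∘ₗ ε))
      p := ({ toFun := q
              map_add' := fun s t => h.inj (by simp [hq])
              map_smul' := fun c s => h.inj (by simp [hq]) } :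
          LinearMap.ker (h.p ∘ₗ ε) →ₗ[MvPolynomial V K] A)
      inj := Submodule.inclusion_injective _
      comp_eq_zero := ?_
      exact := ?_
      surj := ?_
      mem_piece_iff := fun D s => Iff.rfl
      map_piece := ?_
      surj_piece := ?_ }
  · intro s
    exact h.inj ((hq ⟨s.1, _⟩).trans (s.2.trans (map_zero _).symm))
  · intro s hs
    exact ⟨⟨s.1, (hq ⟨s.1, s.2⟩).symm.trans ((congrArg h.i hs).trans (map_zero _))⟩, rfl⟩
  · intro a
    obtain ⟨s, hs⟩ := hεs (h.i a)
    refine ⟨⟨s, ?_⟩, h.inj ?_⟩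
    · rw [LinearMap.mem_ker, LinearMap.comp_apply, hs, h.comp_eq_zero]
    · change h.i (q _) = _
      rw [hq, hs]
  · intro D s hs
    have h1 : h.i (q ⟨s.1, s.2⟩) ∈ B.piece D := by
      rw [hq]
      exact hε _ _ hs
    exact (h.mem_piece_iff _ _).1 h1
  · intro D a ha
    obtain ⟨s, hsD, hs⟩ := hεp D (h.i a) ((h.mem_piece_iff _ _).2 ha)
    refine ⟨⟨s, ?_⟩, hsD, h.inj ?_⟩
    · rw [LinearMap.mem_ker, LinearMap.comp_apply, hs, h.comp_eq_zero]
    · change h.i (q _) = _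
      rw [hq, hs]

theorem isHomogeneous_of_coeff {p : MvPolynomial V K} {D : ℕ}
    (h : ∀ μ, p.coeff μ ≠ 0 → μ.degree = D) : p.IsHomogeneous D := by
  intro μ hμ
  exact (DFunLike.congr_fun Finsupp.degree_eq_weight_one μ).symm.trans (h μ hμ)

/-- A syzygy module in a graded free resolution, together with its regularity. -/
structure RegularSyzygy (K : Type) [Field K] (V : Type) where
  /-- the rank of the ambient free module -/
  rank : ℕ
  /-- the degrees of the generators of the ambient free module -/
  deg : Fin rank → ℕ
  /-- the syzygy module -/
  syz : Submodule (MvPolynomial V K) (Fin rank → MvPolynomial V K)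
  /-- the regularity bound -/
  bound : ℕ
  isRegular : IsRegular (gradedSub deg syz) bound

theorem RegularSyzygy.exists_next (N : RegularSyzygy K V) :
    ∃ (N' : RegularSyzygy K V) (φ : (Fin N'.rank → MvPolynomial V K) →ₗ[MvPolynomial V K]
        (Fin N.rank → MvPolynomial V K)),
      LinearMap.range φ = N.syz ∧ LinearMap.ker φ = N'.syz ∧ N'.bound = N.bound + 1 ∧
      (∀ k, N'.deg k ≤ N.bound) ∧
      ∀ k, φ (Pi.single k 1) ∈ freePiece K V N.deg (N'.deg k) := by
  obtain ⟨n, d, ε, h1, h2, h3, -, h5⟩ := N.isRegular.step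
  change (Fin n → MvPolynomial V K) →ₗ[MvPolynomial V K] N.syz at ε
  replace h3 : Function.Surjective (ε : _ → N.syz) := h3
  have hr : LinearMap.range (N.syz.subtype ∘ₗ ε) = N.syz := by
    rw [LinearMap.range_comp, LinearMap.range_eq_top.2 h3, Submodule.map_top,
      Submodule.range_subtype]
  have hk : LinearMap.ker (N.syz.subtype ∘ₗ ε) = LinearMap.ker ε :=
    LinearMap.ker_comp_of_ker_eq_bot _ N.syz.ker_subtype
  exact ⟨⟨n, d, LinearMap.ker ε, N.bound + 1, h5⟩, N.syz.subtype ∘ₗ ε, hr, hk, rfl, h1,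
    fun k => h2 _ _ (single_mem_freePiece d k)⟩

/-- An `r`-regular graded module isomorphic to an ideal gives a graded free resolution of
the ideal. -/
theorem IsRegular.hasResolutionDegreeBound {M : GradedMod K V} {r : ℕ} (h : IsRegular M r)
    (j : M →ₗ[MvPolynomial V K] MvPolynomial V K) (hj : Function.Injective j)
    (hjD : ∀ D, ∀ m ∈ M.piece D, (j m).IsHomogeneous D) :
    HasResolutionDegreeBound K (LinearMap.range j : Ideal (MvPolynomial V K)) r := by
  obtain ⟨n, d, ε, h1, h2, h3, -, h5⟩ := h.step
  choose next φ hφ using RegularSyzygy.exists_next (K := K) (V := V)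
  let N : ℕ → RegularSyzygy K V := fun i =>
    Nat.rec ⟨n, d, LinearMap.ker ε, r + 1, h5⟩ (fun _ N => next N) i
  have hN : ∀ i, N (i + 1) = next (N i) := fun i => rfl
  have hb : ∀ i, (N i).bound = i + (r + 1) := by
    intro i
    induction i with
    | zero => simp [N]
    | succ i ih => rw [hN, (hφ _).2.2.1, ih]; omega
  refine ⟨fun i => (N i).rank, fun i => (N i).deg, fun i => φ (N i), j ∘ₗ ε, ?_, ?_, ?_, ?_, ?_, ?_⟩
  · intro k
    exact hjD _ _ (h2 _ _ (single_mem_freePiece d k))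
  · intro i k l
    have key := (hφ (N i)).2.2.2.2 k
    refine ⟨isHomogeneous_of_coeff fun μ hμ => ?_, fun hlt => ?_⟩
    · exact Nat.eq_sub_of_add_eq (key l μ hμ)
    · ext μ
      by_contra hμ
      exact hlt.not_ge (le_of_add_le_right (key l μ (by simpa using hμ)).le)
  · rw [LinearMap.range_comp, LinearMap.range_eq_top.2 h3, Submodule.map_top]
  · rw [LinearMap.ker_comp_of_ker_eq_bot _ (LinearMap.ker_eq_bot.2 hj)]
    exact (hφ (N 0)).1
  · intro i
    exact (hφ (N (i + 1))).1.trans (hφ (N i)).2.1.symm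
  · rintro (_ | i) k
    · simpa [N] using h1 k
    · have := (hφ (N i)).2.2.2.1 k
      rw [hb] at this
      exact this.trans_eq (by ring)

section MonomialQuotients

open Classical in
/-- The part of a polynomial supported on a set of exponents. -/
noncomputable def supportPart (P : Set (V →₀ ℕ)) (p : MvPolynomial V K) : MvPolynomial V K :=
  ∑ μ ∈ p.support with μ ∈ P, MvPolynomial.monomial μ (p.coeff μ)

open Classical in
theorem coeff_supportPart (P : Set (V →₀ ℕ)) (p : MvPolynomial V K) (μ : V →₀ ℕ) :
    (supportPart P p).coeff μ = if μ ∈ P then p.coeff μ else 0 := by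
  simp only [supportPart, MvPolynomial.coeff_sum, MvPolynomial.coeff_monomial,
    Finset.sum_ite_eq', Finset.mem_filter, MvPolynomial.mem_support_iff]
  split_ifs <;> simp_all

theorem supportPart_sub (P : Set (V →₀ ℕ)) (p q : MvPolynomial V K) :
    supportPart P (p - q) = supportPart P p - supportPart P q := by
  ext μ
  simp only [coeff_supportPart, MvPolynomial.coeff_sub]
  split_ifs <;> simp

theorem X_mul_supportPart (v : V) (P : Set (V →₀ ℕ)) (p : MvPolynomial V K) :
    MvPolynomial.X v * supportPart {μ | μ + Finsupp.single v 1 ∈ P} p =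
      supportPart P (MvPolynomial.X v * p) := by
  classical
  ext μ
  simp only [coeff_supportPart, MvPolynomial.coeff_X_mul']
  by_cases hv : v ∈ μ.support
  · have : μ - Finsupp.single v 1 + Finsupp.single v 1 = μ := by
      refine tsub_add_cancel_of_le (Finsupp.single_le_iff.2 ?_)
      exact Nat.one_le_iff_ne_zero.2 (Finsupp.mem_support_iff.1 hv)
    simp [hv, this]
  · simp [hv]

theorem supportPart_eq_self {P : Set (V →₀ ℕ)} {p : MvPolynomial V K}
    (h : ∀ μ, p.coeff μ ≠ 0 → μ ∈ P) : supportPart P p = p := by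
  ext μ
  rw [coeff_supportPart]
  split_ifs with hμ
  · rfl
  · exact (not_not.1 fun h' => hμ (h μ h')).symm

/-- Ideals containing, with each polynomial, all its terms. -/
def IsMonomialIdeal (I : Ideal (MvPolynomial V K)) : Prop :=
  ∀ p ∈ I, ∀ P, supportPart P p ∈ I

/-- The ideal spanned by the monomials with exponents in `A`. -/
noncomputable def monIdeal (K : Type) [Field K] {V : Type} (A : Set (V →₀ ℕ)) :
    Ideal (MvPolynomial V K) :=
  Ideal.span ((fun μ => MvPolynomial.monomial μ 1) '' A)

theorem mem_monIdeal_iff_exists_le {A : Set (V →₀ ℕ)} {p : MvPolynomial V K} :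
    p ∈ monIdeal K A ↔ ∀ μ, p.coeff μ ≠ 0 → ∃ ν ∈ A, ν ≤ μ := by
  simp only [monIdeal, MvPolynomial.mem_ideal_span_monomial_image, MvPolynomial.mem_support_iff]

theorem mem_monIdeal {A : Set (V →₀ ℕ)} (hA : IsUpperSet A) {p : MvPolynomial V K} :
    p ∈ monIdeal K A ↔ ∀ μ, p.coeff μ ≠ 0 → μ ∈ A := by
  rw [mem_monIdeal_iff_exists_le]
  exact forall₂_congr fun μ _ => ⟨fun ⟨_, h, hle⟩ => hA hle h, fun h => ⟨μ, h, le_rfl⟩⟩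

theorem isMonomialIdeal_monIdeal (A : Set (V →₀ ℕ)) : IsMonomialIdeal (monIdeal K A) := by
  intro p hp P
  rw [mem_monIdeal_iff_exists_le] at hp ⊢
  intro μ hμ
  rw [coeff_supportPart] at hμ
  split_ifs at hμ
  · exact hp μ hμ
  · exact absurd rfl hμ

/-- The ideal quotient `I : x_v`. -/
noncomputable def colonVar (v : V) (I : Ideal (MvPolynomial V K)) : Ideal (MvPolynomial V K) :=
  Submodule.comap (LinearMap.mulLeft (MvPolynomial V K) (MvPolynomial.X v)) I

theorem mem_colonVar {v : V} {I : Ideal (MvPolynomial V K)} {p : MvPolynomial V K} :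
    p ∈ colonVar v I ↔ MvPolynomial.X v * p ∈ I := Iff.rfl

/-- The ideal `I + (x_v)`. -/
noncomputable def addVar (v : V) (I : Ideal (MvPolynomial V K)) : Ideal (MvPolynomial V K) :=
  I ⊔ Ideal.span {MvPolynomial.X v}

theorem mem_addVar {v : V} {I : Ideal (MvPolynomial V K)} {p : MvPolynomial V K} :
    p ∈ addVar v I ↔ ∃ a ∈ I, ∃ q, p = a + MvPolynomial.X v * q := by
  simp only [addVar, Submodule.mem_sup, Ideal.mem_span_singleton]
  constructor
  · rintro ⟨a, ha, _, ⟨q, rfl⟩, rfl⟩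
    exact ⟨a, ha, q, rfl⟩
  · rintro ⟨a, ha, q, rfl⟩
    exact ⟨a, ha, _, ⟨q, rfl⟩, rfl⟩

theorem le_addVar (v : V) (I : Ideal (MvPolynomial V K)) : I ≤ addVar v I := le_sup_left

theorem span_X_eq_monIdeal (v : V) :
    Ideal.span {(MvPolynomial.X v : MvPolynomial V K)} = monIdeal K {Finsupp.single v 1} := by
  rw [monIdeal, Set.image_singleton]
  rfl

theorem mem_span_X {v : V} {p : MvPolynomial V K} :
    p ∈ Ideal.span {(MvPolynomial.X v : MvPolynomial V K)} ↔ ∀ μ, p.coeff μ ≠ 0 → μ v ≠ 0 := by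
  simp only [span_X_eq_monIdeal, mem_monIdeal_iff_exists_le, Set.mem_singleton_iff,
    exists_eq_left, Finsupp.single_le_iff, Nat.one_le_iff_ne_zero]

/-- Multiplication by a variable `x`, from `I : x` to `I`. -/
noncomputable def mulVar (v : V) (I : Ideal (MvPolynomial V K)) :
    colonVar v I →ₗ[MvPolynomial V K] I where
  toFun a := ⟨MvPolynomial.X v * (a : MvPolynomial V K), a.2⟩
  map_add' _ _ := Subtype.ext (mul_add _ _ _)
  map_smul' _ _ := Subtype.ext (mul_left_comm _ _ _)

theorem mulVar_mem {v : V} {I J : Ideal (MvPolynomial V K)} {a : colonVar v I}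
    (h : (a : MvPolynomial V K) ∈ colonVar v J) : (mulVar v I a : MvPolynomial V K) ∈ J := h

theorem inclusion_mem_addVar {v : V} {I J : Ideal (MvPolynomial V K)} {a : I}
    (h : (a : MvPolynomial V K) ∈ J) :
    (Submodule.inclusion (le_addVar v I) a : MvPolynomial V K) ∈ addVar v J := le_addVar v J h

/-- The polynomials homogeneous of degree `D`, where `1` is given degree `s`. -/
def shiftPiece (K : Type) [Field K] (V : Type) (s D : ℕ) : AddSubgroup (MvPolynomial V K) where
  carrier := {p | ∀ μ, p.coeff μ ≠ 0 → μ.degree + s = D}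
  zero_mem' := by simp
  add_mem' := by
    intro a b ha hb μ h
    by_contra hne
    have h1 : a.coeff μ = 0 := by_contra fun h' => hne (ha μ h')
    have h2 : b.coeff μ = 0 := by_contra fun h' => hne (hb μ h')
    exact h (by simp [h1, h2])
  neg_mem' := by
    intro a ha μ h
    exact ha μ (by simpa using h)

theorem monomial_mul_mem_shiftPiece {s D : ℕ} {p : MvPolynomial V K}
    (hp : p ∈ shiftPiece K V s D) (μ : V →₀ ℕ) (c : K) :
    MvPolynomial.monomial μ c * p ∈ shiftPiece K V s (μ.degree + D) := by
  intro ν h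
  obtain ⟨ρ, rfl, hρ⟩ := coeff_monomial_mul_ne_zero h
  rw [map_add, add_assoc, hp ρ hρ]

theorem supportPart_mem_shiftPiece {s D : ℕ} {p : MvPolynomial V K}
    (hp : p ∈ shiftPiece K V s D) (P : Set (V →₀ ℕ)) :
    supportPart P p ∈ shiftPiece K V s D := by
  intro μ hμ
  rw [coeff_supportPart] at hμ
  split_ifs at hμ
  · exact hp μ hμ
  · exact absurd rfl hμ

/-- The quotient `I / (I ∩ J)` with degrees shifted by `s`. -/
noncomputable def idealQuot (I J : Ideal (MvPolynomial V K)) (s : ℕ) : GradedMod K V where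
  carrier := I ⧸ Submodule.comap I.subtype J
  piece D := ((shiftPiece K V s D).comap I.subtype.toAddMonoidHom).map
    (Submodule.comap I.subtype J).mkQ.toAddMonoidHom
  smul_mem := by
    rintro D μ c _ ⟨a, ha, rfl⟩
    exact ⟨MvPolynomial.monomial μ c • a, monomial_mul_mem_shiftPiece ha μ c,
      (Submodule.comap I.subtype J).mkQ.map_smul _ _⟩

/-- The class of an element of `I` in `I / (I ∩ J)`. -/
noncomputable def idealQuot.mk {I : Ideal (MvPolynomial V K)} (J : Ideal (MvPolynomial V K))
    (s : ℕ) : I →ₗ[MvPolynomial V K] idealQuot I J s :=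
  (Submodule.comap I.subtype J).mkQ

variable {I J : Ideal (MvPolynomial V K)} {s : ℕ}

theorem idealQuot.mk_surjective : Function.Surjective (idealQuot.mk (I := I) J s) :=
  Submodule.mkQ_surjective _

theorem idealQuot.mk_eq_zero {a : I} : idealQuot.mk J s a = 0 ↔ (a : MvPolynomial V K) ∈ J :=
  Submodule.Quotient.mk_eq_zero _

theorem idealQuot.mk_eq_mk {a b : I} :
    idealQuot.mk J s a = idealQuot.mk J s b ↔ (a - b : MvPolynomial V K) ∈ J :=
  Submodule.Quotient.eq _

theorem mem_idealQuot_piece {D : ℕ} {m : idealQuot I J s} :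
    m ∈ (idealQuot I J s).piece D ↔
      ∃ a : I, (a : MvPolynomial V K) ∈ shiftPiece K V s D ∧ idealQuot.mk J s a = m := Iff.rfl

/-- A map of quotients induced by a linear map between ideals. -/
noncomputable def idealQuot.map {I' J' : Ideal (MvPolynomial V K)} {s' : ℕ}
    (f : I →ₗ[MvPolynomial V K] I') (h : ∀ a : I, (a : MvPolynomial V K) ∈ J →
      (f a : MvPolynomial V K) ∈ J') : idealQuot I J s →ₗ[MvPolynomial V K] idealQuot I' J' s' :=
  Submodule.mapQ _ _ f h

theorem idealQuot.map_mk {I' J' : Ideal (MvPolynomial V K)} {s' : ℕ}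
    (f : I →ₗ[MvPolynomial V K] I') (h : ∀ a : I, (a : MvPolynomial V K) ∈ J →
      (f a : MvPolynomial V K) ∈ J') (a : I) :
    idealQuot.map (s := s) (s' := s') f h (idealQuot.mk J s a) = idealQuot.mk J' s' (f a) := rfl

/-- The sequence `0 → (I:x)/(J:x)(-1) → I/J → (I+(x))/(J+(x)) → 0` for a variable `x`. -/
noncomputable def varShortExact (v : V) (hI : IsMonomialIdeal I) (hJ : IsMonomialIdeal J)
    (hJI : J ≤ I) (s : ℕ) : GradedShortExact (idealQuot (colonVar v I) (colonVar v J) (s + 1))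
      (idealQuot I J s) (idealQuot (addVar v I) (addVar v J) s) where
  i := idealQuot.map (mulVar v I) fun _ => mulVar_mem
  p := idealQuot.map (Submodule.inclusion (le_addVar v I)) fun _ => inclusion_mem_addVar
  inj := by
    rw [injective_iff_map_eq_zero]
    intro m hm
    obtain ⟨a, rfl⟩ := idealQuot.mk_surjective m
    rw [idealQuot.map_mk, idealQuot.mk_eq_zero] at hm
    exact idealQuot.mk_eq_zero.2 hm
  comp_eq_zero := by
    intro m
    obtain ⟨a, rfl⟩ := idealQuot.mk_surjective m
    rw [idealQuot.map_mk, idealQuot.map_mk, idealQuot.mk_eq_zero]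
    exact mem_addVar.2 ⟨0, zero_mem _, a, (zero_add _).symm⟩
  exact := by
    intro m hm
    obtain ⟨a, rfl⟩ := idealQuot.mk_surjective m
    rw [idealQuot.map_mk, idealQuot.mk_eq_zero] at hm
    obtain ⟨b, hb, q, hq⟩ := mem_addVar.1 hm
    have hq' : MvPolynomial.X v * q = (a : MvPolynomial V K) - b := eq_sub_of_add_eq' hq.symm
    refine ⟨idealQuot.mk _ _ ⟨q, ?_⟩, ?_⟩
    · rw [mem_colonVar, hq']
      exact sub_mem a.2 (hJI hb)
    · rw [idealQuot.map_mk, idealQuot.mk_eq_mk]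
      change MvPolynomial.X v * q - (a : MvPolynomial V K) ∈ J
      rw [hq', sub_sub_cancel_left]
      exact neg_mem hb
  surj := by
    intro m
    obtain ⟨⟨a, ha⟩, rfl⟩ := idealQuot.mk_surjective m
    obtain ⟨b, hb, q, rfl⟩ := mem_addVar.1 ha
    refine ⟨idealQuot.mk _ _ ⟨b, hb⟩, ?_⟩
    rw [idealQuot.map_mk, idealQuot.mk_eq_mk]
    exact mem_addVar.2 ⟨0, zero_mem _, -q, by simp⟩
  mem_piece_iff := by
    intro D m
    obtain ⟨a, rfl⟩ := idealQuot.mk_surjective m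
    rw [idealQuot.map_mk]
    simp only [mem_idealQuot_piece, idealQuot.mk_eq_mk]
    constructor
    · rintro ⟨b, hb, hba⟩
      change ((b : MvPolynomial V K) - MvPolynomial.X v * (a : MvPolynomial V K)) ∈ J at hba
      set P : Set (V →₀ ℕ) := {μ | μ.degree + s = D} with hP
      have hx := X_mul_supportPart v P (a : MvPolynomial V K)
      refine ⟨⟨supportPart {μ | μ + Finsupp.single v 1 ∈ P} a, ?_⟩, ?_, ?_⟩
      · rw [mem_colonVar, hx]
        exact hI _ a.2 _
      · intro μ hμ
        rw [coeff_supportPart] at hμ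
        split_ifs at hμ with h
        · have h' : (μ + Finsupp.single v 1).degree + s = D := h
          rw [map_add, Finsupp.degree_single] at h'
          omega
        · exact absurd rfl hμ
      · rw [mem_colonVar, mul_sub, hx]
        have := hJ _ hba P
        rw [supportPart_sub, supportPart_eq_self (P := P) (p := (b : MvPolynomial V K)) hb] at this
        have := sub_mem hba this
        rwa [sub_sub_sub_cancel_left] at this
    · rintro ⟨b, hb, hba⟩
      refine ⟨⟨MvPolynomial.X v * (b : MvPolynomial V K), b.2⟩, ?_, ?_⟩
      · have := monomial_mul_mem_shiftPiece hb (Finsupp.single v 1) 1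
        rw [Finsupp.degree_single] at this
        intro μ hμ
        have := this μ hμ
        omega
      · change MvPolynomial.X v * (b : MvPolynomial V K) - MvPolynomial.X v * (a : MvPolynomial V K) ∈ J
        rw [← mul_sub]
        exact hba
  map_piece := by
    rintro D _ ⟨a, ha, rfl⟩
    exact ⟨⟨a, le_addVar v I a.2⟩, ha, rfl⟩
  surj_piece := by
    rintro D _ ⟨⟨a, ha'⟩, ha, rfl⟩
    obtain ⟨b, hb, q, hq⟩ := mem_addVar.1 ha'
    have hz : supportPart {μ : V →₀ ℕ | μ v = 0} (MvPolynomial.X v * q) = 0 := by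
      ext μ
      rw [coeff_supportPart, MvPolynomial.coeff_zero]
      split_ifs with hμ
      · by_contra hne
        exact mem_span_X.1 (Ideal.mem_span_singleton.2 (dvd_mul_right _ q)) μ hne hμ
      · rfl
    have hpart : supportPart {μ : V →₀ ℕ | μ v = 0} a ∈ I := by
      have := hI _ hb {μ | μ v = 0}
      rwa [eq_sub_of_add_eq hq.symm, supportPart_sub, hz, sub_zero] at this
    refine ⟨idealQuot.mk _ _ ⟨_, hpart⟩, ⟨_, supportPart_mem_shiftPiece ha _, rfl⟩, ?_⟩
    refine idealQuot.mk_eq_mk.2 (Submodule.mem_sup_right (mem_span_X.2 fun μ hμ hv => hμ ?_))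
    change (supportPart {μ : V →₀ ℕ | μ v = 0} a - a).coeff μ = 0
    rw [MvPolynomial.coeff_sub, coeff_supportPart, if_pos (show μ ∈ {μ : V →₀ ℕ | μ v = 0} from hv), sub_self]

end MonomialQuotients

theorem isRegular_of_subsingleton (M : GradedMod K V) [Subsingleton M] (r : ℕ) :
    IsRegular M r := by
  refine ⟨fun M _ => Subsingleton M, ?_, ‹_›⟩
  intro M r hM
  exact ⟨0, Fin.elim0, 0, fun k => k.elim0, fun D s _ => (M.piece D).zero_mem,
    fun m => ⟨0, Subsingleton.elim _ _⟩, fun D m _ => ⟨0, zero_mem _, Subsingleton.elim _ _⟩,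
    ⟨fun x y => Subtype.ext (Subsingleton.elim _ _)⟩⟩

theorem isRegular_idealQuot_self (I : Ideal (MvPolynomial V K)) (s r : ℕ) :
    IsRegular (idealQuot I I s) r := by
  have : Subsingleton (idealQuot I I s) := by
    refine subsingleton_of_forall_eq 0 fun m => ?_
    obtain ⟨a, rfl⟩ := idealQuot.mk_surjective m
    exact idealQuot.mk_eq_zero.2 a.2
  exact isRegular_of_subsingleton _ _

theorem isRegular_idealQuot_top_bot {s r : ℕ} (h : s ≤ r) :
    IsRegular (idealQuot (⊤ : Ideal (MvPolynomial V K)) ⊥ s) r := by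
  set ε : (Fin 1 → MvPolynomial V K) →ₗ[MvPolynomial V K]
      idealQuot (⊤ : Ideal (MvPolynomial V K)) ⊥ s :=
    idealQuot.mk ⊥ s ∘ₗ (LinearMap.proj 0).codRestrict ⊤ fun _ => Submodule.mem_top with hε
  have hεa : ∀ f, ε f = idealQuot.mk ⊥ s ⟨f 0, Submodule.mem_top⟩ := fun f => rfl
  refine SyzygyStep.isRegular ⟨1, fun _ => s, ε, fun _ => h, ?_, ?_, ?_, ?_⟩
  · intro D f hf
    exact ⟨⟨f 0, Submodule.mem_top⟩, hf 0, rfl⟩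
  · intro m
    obtain ⟨a, rfl⟩ := idealQuot.mk_surjective m
    exact ⟨fun _ => a, rfl⟩
  · rintro D _ ⟨a, ha, rfl⟩
    exact ⟨fun _ => a, fun _ => ha, rfl⟩
  · have : Subsingleton (gradedSub (fun _ : Fin 1 => s) (LinearMap.ker ε)) := by
      refine ⟨fun x y => Subtype.ext ?_⟩
      have key : ∀ z : LinearMap.ker ε, (z : Fin 1 → MvPolynomial V K) = 0 := by
        rintro ⟨z, hz⟩
        rw [LinearMap.mem_ker, hεa, idealQuot.mk_eq_zero] at hz
        ext k : 1
        rw [Subsingleton.elim k 0]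
        exact hz
      exact (key x).trans (key y).symm
    exact isRegular_of_subsingleton _ _

/-- The exponents lying in `J` or divisible by some variable in `W`. -/
def withVars (W : Set V) (J : Set (V →₀ ℕ)) : Set (V →₀ ℕ) := {c | c ∈ J ∨ ∃ v ∈ W, c v ≠ 0}

/-- Combinatorial certificates that `(J + (W)) / (W)` is `r`-regular, by successively
splitting off variables. -/
inductive Filt : Set V → Set (V →₀ ℕ) → ℕ → Prop
  | zero (W r) : Filt W ∅ r
  | unit (W r) : Filt W Set.univ r
  | split {W J r} (v : V) (hv : v ∉ W) (h₁ : Filt W {c | c + Finsupp.single v 1 ∈ J} r)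
      (h₂ : Filt (insert v W) J (r + 1)) : Filt W J (r + 1)
  | congr {W J J' r} (h : ∀ c : V →₀ ℕ, (∀ v ∈ W, c v = 0) → (c ∈ J ↔ c ∈ J'))
      (h₁ : Filt W J r) : Filt W J' r

theorem monIdeal_mono {A B : Set (V →₀ ℕ)} (h : A ⊆ B) : monIdeal K A ≤ monIdeal K B :=
  Ideal.span_mono (Set.image_mono h)

theorem withVars_mono {W : Set V} {J J' : Set (V →₀ ℕ)} (h : J ⊆ J') :
    withVars W J ⊆ withVars W J' := fun _ hc => hc.imp_left fun h' => h h'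

theorem isUpperSet_withVars_empty (W : Set V) : IsUpperSet (withVars W ∅) := by
  rintro a b hab (h | ⟨v, hv, h⟩)
  · exact h.elim
  · exact Or.inr ⟨v, hv, fun h0 => h (Nat.le_zero.1 (h0 ▸ hab v))⟩

theorem colonVar_monIdeal {A : Set (V →₀ ℕ)} (hA : IsUpperSet A) (v : V) :
    colonVar v (monIdeal K A) = monIdeal K {c | c + Finsupp.single v 1 ∈ A} := by
  have hA' : IsUpperSet {c : V →₀ ℕ | c + Finsupp.single v 1 ∈ A} := fun a b hab h =>
    hA (add_le_add_left hab _) h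
  ext p
  rw [mem_colonVar, mem_monIdeal hA, mem_monIdeal hA', mul_comm]
  constructor
  · intro h μ hμ
    exact h (μ + Finsupp.single v 1) (by rwa [MvPolynomial.coeff_mul_X])
  · intro h μ hμ
    classical
    rw [MvPolynomial.coeff_mul_X'] at hμ
    split_ifs at hμ with hv
    · have := h _ hμ
      rwa [Set.mem_ofPred_eq, tsub_add_cancel_of_le] at this
      exact Finsupp.single_le_iff.2 (Nat.one_le_iff_ne_zero.2 (Finsupp.mem_support_iff.1 hv))
    · exact absurd rfl hμ

theorem addVar_monIdeal (A : Set (V →₀ ℕ)) (v : V) :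
    addVar v (monIdeal K A) = monIdeal K (A ∪ {Finsupp.single v 1}) := by
  rw [addVar, span_X_eq_monIdeal, monIdeal, monIdeal, monIdeal, ← Ideal.span_union,
    Set.image_union]

theorem addVar_monIdeal_withVars (W : Set V) (J : Set (V →₀ ℕ)) (v : V) :
    addVar v (monIdeal K (withVars W J)) = monIdeal K (withVars (insert v W) J) := by
  rw [addVar_monIdeal]
  ext p
  simp only [mem_monIdeal_iff_exists_le]
  refine forall₂_congr fun μ _ => ⟨?_, ?_⟩
  · rintro ⟨ν, (h | ⟨w, hw, h⟩) | rfl, hle⟩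
    · exact ⟨ν, Or.inl h, hle⟩
    · exact ⟨ν, Or.inr ⟨w, Set.mem_insert_of_mem _ hw, h⟩, hle⟩
    · exact ⟨_, Or.inr ⟨v, Set.mem_insert _ _, by simp⟩, hle⟩
  · rintro ⟨ν, h | ⟨w, rfl | hw, h⟩, hle⟩
    · exact ⟨ν, Or.inl (Or.inl h), hle⟩
    · exact ⟨_, Or.inr rfl, (Finsupp.single_le_iff.2 (Nat.one_le_iff_ne_zero.2 h)).trans hle⟩
    · exact ⟨ν, Or.inl (Or.inr ⟨w, hw, h⟩), hle⟩

theorem colon_withVars {W : Set V} {v : V} (hv : v ∉ W) (J : Set (V →₀ ℕ)) :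
    {c | c + Finsupp.single v 1 ∈ withVars W J} =
      withVars W {c | c + Finsupp.single v 1 ∈ J} := by
  classical
  ext c
  refine or_congr Iff.rfl (exists_congr fun w => and_congr_right fun hw => ?_)
  have : v ≠ w := fun h => hv (h ▸ hw)
  simp [this]

theorem isUpperSet_colon {A : Set (V →₀ ℕ)} (hA : IsUpperSet A) (v : V) :
    IsUpperSet {c : V →₀ ℕ | c + Finsupp.single v 1 ∈ A} := fun _ _ hab h =>
  hA (add_le_add_left hab _) h

/-- The exact sequence splitting off the variable `v` from `(J + (W)) / (W)`. -/
theorem exists_splitExact {W : Set V} {v : V} (hv : v ∉ W) {J : Set (V →₀ ℕ)}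
    (hJ : IsUpperSet (withVars W J)) (s : ℕ) :
    Nonempty (GradedShortExact
      (idealQuot (monIdeal K (withVars W {c | c + Finsupp.single v 1 ∈ J}))
        (monIdeal K (withVars W ∅)) (s + 1))
      (idealQuot (monIdeal K (withVars W J)) (monIdeal K (withVars W ∅)) s)
      (idealQuot (monIdeal K (withVars (insert v W) J))
        (monIdeal K (withVars (insert v W) ∅)) s)) := by
  have h1 := colonVar_monIdeal (K := K) hJ v
  have h2 := colonVar_monIdeal (K := K) (isUpperSet_withVars_empty W) v
  rw [colon_withVars hv] at h1 h2
  have h3 := varShortExact v (isMonomialIdeal_monIdeal (K := K) (withVars W J))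
    (isMonomialIdeal_monIdeal (withVars W ∅))
    (monIdeal_mono (withVars_mono (Set.empty_subset J))) s
  rw [h1, h2, addVar_monIdeal_withVars, addVar_monIdeal_withVars] at h3
  exact ⟨h3⟩

theorem monIdeal_univ : monIdeal K (Set.univ : Set (V →₀ ℕ)) = ⊤ :=
  (Ideal.eq_top_iff_one _).2 (Ideal.subset_span ⟨0, trivial, rfl⟩)

theorem withVars_univ (W : Set V) : withVars W Set.univ = Set.univ :=
  Set.eq_univ_of_forall fun _ => Or.inl trivial

theorem isRegular_idealQuot_top_withVars [Finite V] (W : Set V) {s r : ℕ} (h : s ≤ r) :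
    IsRegular (idealQuot (⊤ : Ideal (MvPolynomial V K)) (monIdeal K (withVars W ∅)) s) r := by
  induction W, Set.toFinite W using Set.Finite.induction_on generalizing s r with
  | empty =>
    have : monIdeal K (withVars (∅ : Set V) ∅) = ⊥ := by
      simp [withVars, monIdeal]
    rw [this]
    exact isRegular_idealQuot_top_bot h
  | @insert v W hv _ ih =>
    obtain ⟨hs⟩ := exists_splitExact (K := K) hv (J := Set.univ)
      (by rw [withVars_univ]; exact isUpperSet_univ) s
    simp only [Set.mem_univ, Set.ofPred_true, withVars_univ, monIdeal_univ] at hs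
    exact hs.isRegular_right (ih (by omega)) (ih h)

theorem Filt.isRegular [Finite V] {W : Set V} {J : Set (V →₀ ℕ)} {r : ℕ} (h : Filt W J r) (s : ℕ)
    (hJ : IsUpperSet (withVars W J)) :
    IsRegular (idealQuot (monIdeal K (withVars W J)) (monIdeal K (withVars W ∅)) s) (r + s) := by
  induction h generalizing s with
  | zero W r => exact isRegular_idealQuot_self _ _ _
  | unit W r =>
    rw [withVars_univ, monIdeal_univ]
    exact isRegular_idealQuot_top_withVars W (by omega)
  | @split W J r v hv _ _ ih₁ ih₂ =>
    obtain ⟨hs⟩ := exists_splitExact (K := K) hv hJ s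
    refine hs.isRegular_middle ?_ (ih₂ s ?_)
    · rw [add_assoc, add_comm 1 s]
      refine ih₁ (s + 1) ?_
      rw [← colon_withVars hv]
      exact isUpperSet_colon hJ v
    · rintro a b hab (h | ⟨w, rfl | hw, h⟩)
      · exact (hJ hab (Or.inl h)).imp_right fun ⟨w, hw, h⟩ => ⟨w, Set.mem_insert_of_mem _ hw, h⟩
      · exact Or.inr ⟨w, Set.mem_insert _ _, fun h0 => h (Nat.le_zero.1 (h0 ▸ hab w))⟩
      · exact Or.inr ⟨w, Set.mem_insert_of_mem _ hw, fun h0 => h (Nat.le_zero.1 (h0 ▸ hab w))⟩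
  | @congr W J J' r hc _ ih =>
    have : withVars W J = withVars W J' := by
      ext c
      by_cases hex : ∃ v ∈ W, c v ≠ 0
      · exact ⟨fun _ => Or.inr hex, fun _ => Or.inr hex⟩
      · push Not at hex
        exact or_congr_left (hc c hex)
    rw [← this] at hJ ⊢
    exact ih s hJ

theorem Filt.hasResolutionDegreeBound [Finite V] {J : Set (V →₀ ℕ)} {r : ℕ} (h : Filt ∅ J r)
    (hJ : IsUpperSet J) : HasResolutionDegreeBound K (monIdeal K J) r := by
  have hW : ∀ J : Set (V →₀ ℕ), withVars ∅ J = J := fun J => by simp [withVars]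
  have hreg := h.isRegular (K := K) 0 (by rwa [hW])
  have hbot : monIdeal K (∅ : Set (V →₀ ℕ)) = ⊥ := by simp [monIdeal]
  rw [hW, hW, hbot, add_zero] at hreg
  have hle : Submodule.comap (monIdeal K J).subtype (⊥ : Ideal (MvPolynomial V K)) ≤
      LinearMap.ker (monIdeal K J).subtype := fun a ha => ha
  set j : idealQuot (monIdeal K J) ⊥ 0 →ₗ[MvPolynomial V K] MvPolynomial V K :=
    Submodule.liftQ _ (monIdeal K J).subtype hle with hj
  have hjm : ∀ a : monIdeal K J, j (idealQuot.mk ⊥ 0 a) = a := fun a => rfl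
  have hr : LinearMap.range j = monIdeal K J := by
    ext p
    constructor
    · rintro ⟨m, rfl⟩
      obtain ⟨a, rfl⟩ := idealQuot.mk_surjective m
      exact a.2
    · intro hp
      exact ⟨idealQuot.mk _ _ ⟨p, hp⟩, rfl⟩
  rw [← hr]
  refine hreg.hasResolutionDegreeBound j ?_ ?_
  · rw [injective_iff_map_eq_zero]
    intro m hm
    obtain ⟨a, rfl⟩ := idealQuot.mk_surjective m
    exact idealQuot.mk_eq_zero.2 hm
  · rintro D _ ⟨a, ha, rfl⟩
    exact isHomogeneous_of_coeff fun μ hμ => ha μ hμ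

end GradedModules

section EdgeMultisets

variable {V : Type}

/-- The exponent vector of the monomial of an edge. -/
noncomputable def edgeVec : Sym2 V → (V →₀ ℕ) :=
  Sym2.lift ⟨fun a b => Finsupp.single a 1 + Finsupp.single b 1, fun _ _ => add_comm _ _⟩

@[simp]
theorem edgeVec_mk (a b : V) : edgeVec s(a, b) = Finsupp.single a 1 + Finsupp.single b 1 := rfl

/-- The exponent vector of the product of a multiset of edges. -/
noncomputable def degVec (E : Multiset (Sym2 V)) : V →₀ ℕ := (E.map edgeVec).sum

@[simp]
theorem degVec_zero : degVec (0 : Multiset (Sym2 V)) = 0 := rfl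

@[simp]
theorem degVec_cons (e : Sym2 V) (E : Multiset (Sym2 V)) :
    degVec (e ::ₘ E) = edgeVec e + degVec E := by simp [degVec]

@[simp]
theorem degVec_add (E F : Multiset (Sym2 V)) : degVec (E + F) = degVec E + degVec F := by
  simp [degVec]

theorem degVec_mono {E F : Multiset (Sym2 V)} (h : E ≤ F) : degVec E ≤ degVec F := by
  obtain ⟨D, rfl⟩ := Multiset.le_iff_exists_add.1 h
  simp

theorem degree_edgeVec (e : Sym2 V) : (edgeVec e).degree = 2 := by
  induction e with
  | _ a b => simp

theorem degree_degVec (E : Multiset (Sym2 V)) : (degVec E).degree = 2 * E.card := by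
  induction E using Multiset.induction_on with
  | empty => simp
  | cons e E ih =>
    rw [degVec_cons, map_add, ih, degree_edgeVec, Multiset.card_cons]
    ring

/-- A multiset of edges of a graph. -/
def IsEdges (G : SimpleGraph V) (E : Multiset (Sym2 V)) : Prop := ∀ e ∈ E, e ∈ G.edgeSet

theorem IsEdges.mono {G : SimpleGraph V} {E F : Multiset (Sym2 V)} (hF : IsEdges G F)
    (h : E ≤ F) : IsEdges G E := fun e he => hF e (Multiset.mem_of_le h he)

theorem IsEdges.add {G : SimpleGraph V} {E F : Multiset (Sym2 V)} (hE : IsEdges G E)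
    (hF : IsEdges G F) : IsEdges G (E + F) := fun e he =>
  (Multiset.mem_add.1 he).elim (hE e) (hF e)

theorem IsEdges.cons {G : SimpleGraph V} {a b : V} {E : Multiset (Sym2 V)} (hE : IsEdges G E)
    (h : G.Adj a b) : IsEdges G (s(a, b) ::ₘ E) := fun e he =>
  (Multiset.mem_cons.1 he).elim (fun h' => h' ▸ h) (hE e)

theorem IsEdges.adj {G : SimpleGraph V} {a b : V} {E : Multiset (Sym2 V)} (hE : IsEdges G E)
    (h : s(a, b) ∈ E) : G.Adj a b := hE _ h

theorem isEdges_cons {G : SimpleGraph V} {a b : V} {E : Multiset (Sym2 V)} :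
    IsEdges G (s(a, b) ::ₘ E) ↔ G.Adj a b ∧ IsEdges G E := by
  simp [IsEdges]

theorem isEdges_zero (G : SimpleGraph V) : IsEdges G 0 := by simp [IsEdges]

theorem exists_mem_of_degVec_ne_zero {E : Multiset (Sym2 V)} {v : V} (h : degVec E v ≠ 0) :
    ∃ a E', E = s(v, a) ::ₘ E' := by
  suffices ∃ a, s(v, a) ∈ E by
    obtain ⟨a, ha⟩ := this
    exact ⟨a, Multiset.exists_cons_of_mem ha⟩
  induction E using Multiset.induction_on with
  | empty => simp at h
  | cons e E ih =>
    by_cases hE : degVec E v = 0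
    · induction e with
      | _ a b =>
        classical
        by_cases hva : a = v
        · exact ⟨b, by simp [hva]⟩
        by_cases hvb : b = v
        · exact ⟨a, by simp [hvb, Sym2.eq_swap]⟩
        · simp [hE, hva, hvb] at h
    · obtain ⟨a, ha⟩ := ih hE
      exact ⟨a, Multiset.mem_cons_of_mem ha⟩

theorem degVec_ne_zero_of_mem {E : Multiset (Sym2 V)} {v a : V} (h : s(v, a) ∈ E) :
    degVec E v ≠ 0 := by
  obtain ⟨E', rfl⟩ := Multiset.exists_cons_of_mem h
  simp

/-- Alternating trails: starting from a vertex `v` with larger `E`-degree than `F`-degree, an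
alternating trail can be continued until it reaches a vertex with a similar defect. -/
theorem exists_alternating_trail {G : SimpleGraph V} {E F : Multiset (Sym2 V)} {v : V}
    (hE : IsEdges G E) (hF : IsEdges G F) (h : degVec F v < degVec E v) :
    ∃ E₁ ≤ E, ∃ F₁ ≤ F,
      (∃ w, degVec E₁ = degVec F₁ + Finsupp.single v 1 + Finsupp.single w 1 ∧
        (degVec F + Finsupp.single v 1 : V →₀ ℕ) w < degVec E w) ∨
      (∃ z, degVec E₁ + Finsupp.single z 1 = degVec F₁ + Finsupp.single v 1 ∧
        degVec E z < degVec F z) := by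
  classical
  induction hn : E.card generalizing E F v with
  | zero =>
    rw [Multiset.card_eq_zero.1 hn] at h
    simp at h
  | succ n ih =>
    obtain ⟨a, E', rfl⟩ := exists_mem_of_degVec_ne_zero (Nat.ne_zero_of_lt h)
    obtain ⟨hva, hE'⟩ := isEdges_cons.1 hE
    have hva' := hva.ne
    by_cases ha : degVec F a < degVec (s(v, a) ::ₘ E') a
    · refine ⟨{s(v, a)}, by simp, 0, by simp, Or.inl ⟨a, ?_, ?_⟩⟩
      · simp [degVec]
      · simpa [hva'] using ha
    have hFa : degVec F a ≠ 0 := by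
      simp only [degVec_cons, edgeVec_mk, Finsupp.add_apply, Finsupp.single_eq_same] at ha
      omega
    obtain ⟨b, F', rfl⟩ := exists_mem_of_degVec_ne_zero hFa
    obtain ⟨hab, hF'⟩ := isEdges_cons.1 hF
    by_cases hb : degVec (s(v, a) ::ₘ E') b < degVec (s(a, b) ::ₘ F') b
    · refine ⟨{s(v, a)}, by simp, {s(a, b)}, by simp, Or.inr ⟨b, ?_, hb⟩⟩
      simp only [degVec, Multiset.map_singleton, Multiset.sum_singleton, edgeVec_mk]
      abel
    have hb' : degVec F' b < degVec E' b := by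
      simp only [degVec_cons, edgeVec_mk, Finsupp.add_apply, Finsupp.single_apply] at ha hb h
      have := hab.ne
      by_cases hvb : v = b
      · subst hvb
        simp_all
      · simp_all
        omega
    obtain ⟨E₁, hE₁, F₁, hF₁, ⟨w, h1, h2⟩ | ⟨z, h1, h2⟩⟩ := ih hE' hF' hb' (by simpa using hn)
    · refine ⟨s(v, a) ::ₘ E₁, Multiset.cons_le_cons _ hE₁, s(a, b) ::ₘ F₁,
        Multiset.cons_le_cons _ hF₁, Or.inl ⟨w, ?_, ?_⟩⟩
      · simp only [degVec_cons, edgeVec_mk, h1]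
        abel
      · simp only [degVec_cons, edgeVec_mk, Finsupp.add_apply] at h2 ⊢
        omega
    · refine ⟨s(v, a) ::ₘ E₁, Multiset.cons_le_cons _ hE₁, s(a, b) ::ₘ F₁,
        Multiset.cons_le_cons _ hF₁, Or.inr ⟨z, ?_, ?_⟩⟩
      · have := congrArg (fun x => Finsupp.single v 1 + Finsupp.single a 1 + x) h1
        simp only [degVec_cons, edgeVec_mk] at this ⊢
        rw [add_assoc, this]
        abel
      · by_cases hzv : z = v
        · subst hzv
          simp only [degVec_cons, edgeVec_mk, Finsupp.add_apply] at h2 h ⊢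
          simp only [Finsupp.single_apply] at h2 h ⊢
          split_ifs at h ⊢ <;> simp_all
          omega
        · simp only [degVec_cons, edgeVec_mk, Finsupp.add_apply,
            Finsupp.single_eq_of_ne hzv] at h2 ⊢
          omega

theorem exists_defect_pair {G : SimpleGraph V} {E F : Multiset (Sym2 V)}
    (hE : IsEdges G E) (hF : IsEdges G F) (h : F.card < E.card) :
    ∃ E₁ ≤ E, ∃ F₁ ≤ F, ∃ p q,
      degVec E₁ = degVec F₁ + Finsupp.single p 1 + Finsupp.single q 1 ∧
      degVec F p < degVec E p ∧ (degVec F + Finsupp.single p 1 : V →₀ ℕ) q < degVec E q := by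
  classical
  induction hn : E.card using Nat.strong_induction_on generalizing E F with
  | _ n ih =>
    have hv : ∃ v, degVec F v < degVec E v := by
      by_contra! hle
      have := Finsupp.degree_mono (show degVec E ≤ degVec F from hle)
      rw [degree_degVec, degree_degVec] at this
      omega
    obtain ⟨v, hv⟩ := hv
    obtain ⟨E₁, hE₁, F₁, hF₁, ⟨w, h1, h2⟩ | ⟨z, h1, h2⟩⟩ := exists_alternating_trail hE hF hv
    · exact ⟨E₁, hE₁, F₁, hF₁, v, w, h1, hv, h2⟩
    · have hcard : E₁.card = F₁.card := by
        have := congrArg Finsupp.degree h1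
        simp only [map_add, degree_degVec, Finsupp.degree_single] at this
        omega
      have hzv : z ≠ v := by
        rintro rfl
        omega
      have hpos : 0 < E₁.card := by
        rw [Nat.pos_iff_ne_zero]
        intro h0
        rw [Multiset.card_eq_zero.1 h0, Multiset.card_eq_zero.1 (hcard.symm.trans h0)] at h1
        have := DFunLike.congr_fun h1 z
        simp [hzv] at this
      obtain ⟨E₂, rfl⟩ := Multiset.le_iff_exists_add.1 hE₁
      obtain ⟨F₂, rfl⟩ := Multiset.le_iff_exists_add.1 hF₁
      rw [Multiset.card_add] at hn
      rw [Multiset.card_add, Multiset.card_add] at h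
      obtain ⟨E₃, hE₃, F₃, hF₃, p, q, h3, h4, h5⟩ := ih E₂.card (by omega)
        (E := E₂) (F := F₂) (hE.mono (by simp)) (hF.mono (by simp)) (by omega) rfl
      refine ⟨E₃, hE₃.trans (by simp), F₃, hF₃.trans (by simp), p, q, h3, ?_, ?_⟩
      · have hp := DFunLike.congr_fun h1 p
        by_cases hpz : p = z
        · subst hpz
          simp [hzv] at *
          omega
        · simp [hpz] at *
          omega
      · have hq := DFunLike.congr_fun h1 q
        by_cases hqz : q = z
        · subst hqz
          simp [hzv] at *
          omega
        · simp [hqz] at *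
          omega

end EdgeMultisets

section NeighborhoodReduction

variable {V : Type}

/-- The graph `G` with all edges meeting the closed neighborhood of `x` removed; such an edge
always meets the open neighborhood. -/
def isolateNbhd (G : SimpleGraph V) (x : V) : SimpleGraph V where
  Adj a b := G.Adj a b ∧ ¬ G.Adj x a ∧ ¬ G.Adj x b
  symm := ⟨fun _ _ h => ⟨h.1.symm, h.2.2, h.2.1⟩⟩
  loopless := ⟨fun _ h => h.1.ne rfl⟩

theorem isolateNbhd_le (G : SimpleGraph V) (x : V) : isolateNbhd G x ≤ G := fun _ _ h => h.1

/-- The graph `G` with all edges at `x` removed. -/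
def isolate (G : SimpleGraph V) (x : V) : SimpleGraph V where
  Adj a b := G.Adj a b ∧ a ≠ x ∧ b ≠ x
  symm := ⟨fun _ _ h => ⟨h.1.symm, h.2.2, h.2.1⟩⟩
  loopless := ⟨fun _ h => h.1.ne rfl⟩

theorem isolate_le (G : SimpleGraph V) (x : V) : isolate G x ≤ G := fun _ _ h => h.1

theorem IsEdges.mono_graph {G H : SimpleGraph V} {E : Multiset (Sym2 V)} (hE : IsEdges G E)
    (h : G ≤ H) : IsEdges H E := fun e he => SimpleGraph.edgeSet_mono h (hE e he)

/-- The vertices even-connected to `x` with respect to `M`. -/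
def evenNbhd (G : SimpleGraph V) (M : Multiset (Sym2 V)) (x : V) : Set V :=
  {y | ∃ E, IsEdges G E ∧ degVec E = degVec M + Finsupp.single x 1 + Finsupp.single y 1}

theorem evenNbhd_mono {G : SimpleGraph V} {F M : Multiset (Sym2 V)} (hM : IsEdges G M)
    (h : F ≤ M) (x : V) : evenNbhd G F x ⊆ evenNbhd G M x := by
  rintro y ⟨E, hE, hd⟩
  obtain ⟨D, rfl⟩ := Multiset.le_iff_exists_add.1 h
  refine ⟨E + D, hE.add (hM.mono (by simp)), ?_⟩
  rw [degVec_add, degVec_add, hd]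
  abel

theorem exists_isolateNbhd_pair {G : SimpleGraph V} {E F : Multiset (Sym2 V)} {x p q : V}
    (hE : IsEdges G E) (hF : IsEdges G F)
    (hd : degVec E = degVec F + Finsupp.single p 1 + Finsupp.single q 1)
    (hp : p ∉ evenNbhd G F x) (hq : q ∉ evenNbhd G F x) :
    ∃ E' F', IsEdges (isolateNbhd G x) E' ∧ IsEdges (isolateNbhd G x) F' ∧ F' ≤ F ∧
      degVec E' = degVec F' + Finsupp.single p 1 + Finsupp.single q 1 := by
  classical
  induction hn : F.card using Nat.strong_induction_on generalizing E F with
  | _ n ih =>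
    have hFE : degVec F ≤ degVec E := by
      rw [hd, add_assoc]
      exact le_self_add
    have hpx : x ≠ p := by
      rintro rfl
      exact hq ⟨E, hE, hd⟩
    have hqx : x ≠ q := by
      rintro rfl
      exact hp ⟨E, hE, by rw [hd, add_right_comm]⟩
    by_cases hall : IsEdges (isolateNbhd G x) E
    · refine ⟨E, F, hall, ?_, le_rfl, hd⟩
      have key : ∀ a, degVec F a ≠ 0 → ¬ G.Adj x a := by
        intro a ha
        have : degVec E a ≠ 0 := fun h0 => ha (Nat.le_zero.1 (h0 ▸ hFE a))
        obtain ⟨b, E', rfl⟩ := exists_mem_of_degVec_ne_zero this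
        exact (isEdges_cons.1 hall).1.2.1
      intro e he
      induction e with
      | _ a b =>
        refine ⟨hF.adj he, key a (degVec_ne_zero_of_mem he), key b ?_⟩
        rw [Sym2.eq_swap] at he
        exact degVec_ne_zero_of_mem he
    by_cases hEx : degVec E x = 0
    · have hy : ∃ y r, G.Adj x y ∧ s(y, r) ∈ E := by
        simp only [IsEdges, not_forall] at hall
        obtain ⟨e, he, hne⟩ := hall
        induction e with
        | _ a b =>
          by_cases ha : G.Adj x a
          · exact ⟨a, b, ha, he⟩
          · refine ⟨b, a, ?_, by rwa [Sym2.eq_swap]⟩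
            by_contra hb
            exact hne ⟨hE.adj he, ha, hb⟩
      obtain ⟨y, r, hxy, hyr⟩ := hy
      obtain ⟨E₀, rfl⟩ := Multiset.exists_cons_of_mem hyr
      have hE₀ := (isEdges_cons.1 hE).2
      have hcard : (s(y, r) ::ₘ E₀).card = F.card + 1 := by
        have := congrArg Finsupp.degree hd
        simp only [map_add, degree_degVec, Finsupp.degree_single] at this
        omega
      rw [Multiset.card_cons] at hcard
      have hd' : ∀ a, degVec (s(x, y) ::ₘ E₀) a + Finsupp.single r 1 a =
          degVec F a + Finsupp.single p 1 a + Finsupp.single q 1 a + Finsupp.single x 1 a := by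
        intro a
        have := DFunLike.congr_fun hd a
        simp only [degVec_cons, edgeVec_mk, Finsupp.add_apply] at this ⊢
        omega
      have hFx : degVec F x = 0 := Nat.le_zero.1 (hEx ▸ hFE x)
      obtain ⟨E₃, hE₃, F₃, hF₃, p', q', h1, h2, h3⟩ := exists_defect_pair
        (hE₀.cons hxy) hF (by rw [Multiset.card_cons]; omega)
      have hE₃' : IsEdges G E₃ := (hE₀.cons hxy).mono hE₃
      have hx : p' ≠ x ∧ q' ≠ x := by
        constructor
        · rintro rfl
          have hq' : q' = p ∨ q' = q := by
            have := hd' q'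
            by_contra! hne
            rw [Finsupp.add_apply] at h3
            rw [Finsupp.single_eq_of_ne hne.1, Finsupp.single_eq_of_ne hne.2] at this
            omega
          rcases hq' with rfl | rfl
          · exact hp (evenNbhd_mono hF hF₃ _ ⟨E₃, hE₃', h1⟩)
          · exact hq (evenNbhd_mono hF hF₃ _ ⟨E₃, hE₃', h1⟩)
        · rintro rfl
          have hp' : p' = p ∨ p' = q := by
            have := hd' p'
            by_contra! hne
            rw [Finsupp.single_eq_of_ne hne.1, Finsupp.single_eq_of_ne hne.2] at this
            by_cases hpq : p' = q'
            · subst hpq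
              rw [Finsupp.add_apply] at h3
              omega
            · rw [Finsupp.single_eq_of_ne hpq] at this
              omega
          rw [add_right_comm] at h1
          rcases hp' with rfl | rfl
          · exact hp (evenNbhd_mono hF hF₃ _ ⟨E₃, hE₃', h1⟩)
          · exact hq (evenNbhd_mono hF hF₃ _ ⟨E₃, hE₃', h1⟩)
      have hpq : Finsupp.single p' 1 + Finsupp.single q' 1 =
          (Finsupp.single p 1 + Finsupp.single q 1 : V →₀ ℕ) := by
        have hp' : p' = p ∨ p' = q := by
          have := hd' p'
          by_contra! hne
          rw [Finsupp.single_eq_of_ne hne.1, Finsupp.single_eq_of_ne hne.2,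
            Finsupp.single_eq_of_ne hx.1] at this
          omega
        have := hd' q'
        rw [Finsupp.add_apply] at h3
        rw [Finsupp.single_eq_of_ne hx.2] at this
        rcases hp' with rfl | rfl
        · have hq' : q' = q := by
            by_contra hne
            rw [Finsupp.single_eq_of_ne hne] at this
            omega
          rw [hq']
        · have hq' : q' = p := by
            by_contra hne
            rw [Finsupp.single_eq_of_ne hne] at this
            omega
          rw [hq', add_comm]
      have h1' : degVec E₃ = degVec F₃ + Finsupp.single p 1 + Finsupp.single q 1 := by
        rw [h1, add_assoc, hpq, add_assoc]
      have hlt : F₃.card < n := by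
        rw [← hn]
        refine lt_of_le_of_ne (Multiset.card_le_card hF₃) fun hc => ?_
        have hF₃' : F₃ = F := Multiset.eq_of_le_of_card_le hF₃ hc.ge
        have hcard₃ := congrArg Finsupp.degree h1'
        simp only [map_add, degree_degVec, Finsupp.degree_single] at hcard₃
        have hE₃'' : E₃ = s(x, y) ::ₘ E₀ :=
          Multiset.eq_of_le_of_card_le hE₃ (by rw [Multiset.card_cons]; omega)
        have := DFunLike.congr_fun h1' x
        simp [hE₃'', hF₃', hFx, hpx, hqx] at this
      obtain ⟨E', F', h4, h5, h6, h7⟩ := ih _ hlt hE₃' (hF.mono hF₃) h1'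
        (fun h => hp (evenNbhd_mono hF hF₃ _ h)) (fun h => hq (evenNbhd_mono hF hF₃ _ h)) rfl
      exact ⟨E', F', h4, h5, h6.trans hF₃, h7⟩
    · have hdx := DFunLike.congr_fun hd x
      simp only [Finsupp.add_apply, Finsupp.single_eq_of_ne hpx, Finsupp.single_eq_of_ne hqx,
        add_zero] at hdx
      obtain ⟨z, F₀, rfl⟩ := exists_mem_of_degVec_ne_zero (hdx ▸ hEx)
      obtain ⟨hxz, hF₀⟩ := isEdges_cons.1 hF
      obtain ⟨E₂, hE₂, F₂, hF₂, ⟨w, h1, h2⟩ | ⟨z', h1, h2⟩⟩ :=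
        exists_alternating_trail (v := x) hE hF₀ (by rw [hdx]; simp)
      · have hw : w = z ∨ w = p ∨ w = q := by
          by_contra! hne
          have := DFunLike.congr_fun hd w
          simp only [degVec_cons, edgeVec_mk, Finsupp.add_apply, Finsupp.single_eq_of_ne hne.1,
            Finsupp.single_eq_of_ne hne.2.1, Finsupp.single_eq_of_ne hne.2.2] at this h2
          omega
        have hle : F₀ ≤ s(x, z) ::ₘ F₀ := Multiset.le_cons_self _ _
        have hmem : w ∈ evenNbhd G (s(x, z) ::ₘ F₀) x :=
          evenNbhd_mono hF (hF₂.trans hle) _ ⟨E₂, hE.mono hE₂, h1⟩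
        rcases hw with rfl | rfl | rfl
        · obtain ⟨E₃, rfl⟩ := Multiset.le_iff_exists_add.1 hE₂
          obtain ⟨F₃, rfl⟩ := Multiset.le_iff_exists_add.1 hF₂
          have hF₃ : F₃ ≤ s(x, w) ::ₘ (F₂ + F₃) := (Multiset.le_add_left _ _).trans hle
          have h3 : degVec E₃ = degVec F₃ + Finsupp.single p 1 + Finsupp.single q 1 := by
            simp only [degVec_cons, degVec_add, edgeVec_mk, h1] at hd
            refine add_left_cancel (a := degVec F₂ + Finsupp.single x 1 + Finsupp.single w 1) ?_
            rw [hd]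
            abel
          obtain ⟨E', F', h4, h5, h6, h7⟩ := ih F₃.card (by simp [← hn])
            (hE.mono (Multiset.le_add_left _ _)) (hF.mono hF₃) h3
            (fun h => hp (evenNbhd_mono hF hF₃ _ h)) (fun h => hq (evenNbhd_mono hF hF₃ _ h)) rfl
          exact ⟨E', F', h4, h5, h6.trans hF₃, h7⟩
        · exact absurd hmem hp
        · exact absurd hmem hq
      · have h3 := degVec_mono (Multiset.le_cons_self F₀ s(x, z)) z'
        have h4 := hFE z'
        omega

end NeighborhoodReduction

section ColonReduction

variable {V : Type}

theorem card_eq_of_degVec_eq {E F : Multiset (Sym2 V)} {p q : V}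
    (h : degVec E = degVec F + Finsupp.single p 1 + Finsupp.single q 1) :
    E.card = F.card + 1 := by
  have := congrArg Finsupp.degree h
  simp only [map_add, degree_degVec, Finsupp.degree_single] at this
  omega

open Classical in
theorem exists_isolateNbhd_le {G : SimpleGraph V} {E M : Multiset (Sym2 V)} {x : V} {l : ℕ}
    {u : V →₀ ℕ} (hE : IsEdges G E) (hM : IsEdges G M) (hl : E.card = M.card + l)
    (hu : ∀ y ∈ evenNbhd G M x, u y = 0)
    (h : degVec E ≤ u + Finsupp.single x 1 + degVec M) :
    ∃ E', IsEdges (isolateNbhd G x) E' ∧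
      E'.card = (M.filter (· ∈ (isolateNbhd G x).edgeSet)).card + l ∧
      degVec E' ≤ u + degVec (M.filter (· ∈ (isolateNbhd G x).edgeSet)) := by
  induction l generalizing E M u with
  | zero => exact ⟨_, fun e he => (Multiset.mem_filter.1 he).2, by simp, le_add_self⟩
  | succ l ih =>
    obtain ⟨E₁, hE₁, F₁, hF₁, p, q, h1, h2, h3⟩ := exists_defect_pair hE hM (by omega)
    have hup := h p
    have huq := h q
    have hsub := evenNbhd_mono hM hF₁ x
    have hpx : p ≠ x := by
      rintro rfl
      have := hu q (hsub ⟨E₁, hE.mono hE₁, h1⟩)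
      simp only [Finsupp.add_apply] at hup huq h3
      omega
    have hqx : q ≠ x := by
      rintro rfl
      have := hu p (hsub ⟨E₁, hE.mono hE₁, by rw [h1, add_right_comm]⟩)
      simp only [Finsupp.add_apply, Finsupp.single_eq_of_ne hpx] at hup
      omega
    simp only [Finsupp.add_apply, Finsupp.single_eq_of_ne hpx, Finsupp.single_eq_of_ne hqx]
      at hup huq h3
    have hpqu : Finsupp.single p 1 + Finsupp.single q 1 ≤ u := by
      intro a
      simp only [Finsupp.add_apply, Finsupp.single_apply] at h3 ⊢
      split_ifs at h3 ⊢ <;> simp_all <;> omega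
    obtain ⟨u', rfl⟩ := exists_add_of_le hpqu
    obtain ⟨E₂, rfl⟩ := Multiset.le_iff_exists_add.1 hE₁
    obtain ⟨F₂, rfl⟩ := Multiset.le_iff_exists_add.1 hF₁
    have hcard := card_eq_of_degVec_eq h1
    obtain ⟨E', F', h4, h5, h6, h7⟩ := exists_isolateNbhd_pair (x := x) (hE.mono hE₁)
      (hM.mono hF₁) h1 (fun hp => by have := hu p (hsub hp); simp at this)
      (fun hp => by have := hu q (hsub hp); simp at this)
    obtain ⟨E'', h8, h9, h10⟩ := ih (E := E₂) (M := F₂) (u := u') (hE.mono (by simp))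
      (hM.mono (by simp)) (by simp only [Multiset.card_add] at hl; omega)
      (fun y hy => by
        have := hu y (evenNbhd_mono hM (Multiset.le_add_left _ _) x hy)
        rw [Finsupp.add_apply] at this
        omega)
      (by
        rw [degVec_add, degVec_add, h1] at h
        refine le_of_add_le_add_left (a := degVec F₁ + Finsupp.single p 1 + Finsupp.single q 1) ?_
        convert h using 1
        abel)
    have hF' : F' ≤ F₁.filter (· ∈ (isolateNbhd G x).edgeSet) :=
      Multiset.le_filter.2 ⟨h6, h5⟩
    obtain ⟨R, hR⟩ := Multiset.le_iff_exists_add.1 hF'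
    refine ⟨E'' + E' + R, (h8.add h4).add fun e he => ?_, ?_, ?_⟩
    · have : e ∈ F₁.filter (· ∈ (isolateNbhd G x).edgeSet) := hR ▸ Multiset.mem_add.2 (Or.inr he)
      exact (Multiset.mem_filter.1 this).2
    · rw [Multiset.filter_add, hR]
      simp only [Multiset.card_add, h9, card_eq_of_degVec_eq h7]
      omega
    · rw [Multiset.filter_add, hR]
      simp only [degVec_add, h7]
      calc _ ≤ u' + degVec (F₂.filter (· ∈ (isolateNbhd G x).edgeSet)) +
            (degVec F' + Finsupp.single p 1 + Finsupp.single q 1) + degVec R := by gcongr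
        _ = _ := by abel

theorem exists_drop_edge {G : SimpleGraph V} {E : Multiset (Sym2 V)} {w : V →₀ ℕ} {x : V} {m : ℕ}
    (hE : IsEdges G E) (hm : E.card = m + 1) (h : degVec E ≤ w + Finsupp.single x 1) :
    ∃ E', IsEdges G E' ∧ E'.card = m ∧ degVec E' ≤ w := by
  classical
  by_cases hx : degVec E x = 0
  · obtain ⟨e, he⟩ := Multiset.card_pos_iff_exists_mem.1 (by omega : 0 < E.card)
    obtain ⟨E', rfl⟩ := Multiset.exists_cons_of_mem he
    refine ⟨E', hE.mono (Multiset.le_cons_self _ _), by simpa using hm, fun a => ?_⟩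
    have h1 := h a
    have h2 := degVec_mono (Multiset.le_cons_self E' e)
    by_cases hax : a = x
    · subst hax
      have := h2 a
      omega
    · rw [Finsupp.add_apply, Finsupp.single_eq_of_ne hax] at h1
      exact (h2 a).trans h1
  · obtain ⟨a, E', rfl⟩ := exists_mem_of_degVec_ne_zero hx
    refine ⟨E', hE.mono (Multiset.le_cons_self _ _), by simpa using hm, ?_⟩
    rw [degVec_cons, edgeVec_mk, add_assoc, add_comm w] at h
    exact le_add_self.trans (le_of_add_le_add_left h)

theorem exists_le_of_even_free {G : SimpleGraph V} {E M : Multiset (Sym2 V)} {x y : V} {m : ℕ}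
    {u : V →₀ ℕ} (hE : IsEdges G E) (hM : IsEdges G M) (hm : E.card = m + 1)
    (hu : ∀ v ∈ evenNbhd G M y, u v = 0)
    (h : degVec E ≤ u + degVec M + Finsupp.single x 1 + Finsupp.single y 1) :
    ∃ E', IsEdges G E' ∧ E'.card = m ∧ degVec E' ≤ u + degVec M := by
  classical
  by_cases hy : degVec E y ≤ (u + degVec M + Finsupp.single x 1 : V →₀ ℕ) y
  · refine exists_drop_edge hE hm (x := x) fun a => ?_
    by_cases hay : a = y
    · subst hay
      exact hy
    · simpa [Finsupp.single_eq_of_ne hay] using h a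
  obtain ⟨E₁, hE₁, F₁, hF₁, ⟨w, h1, h2⟩ | ⟨z, h1, h2⟩⟩ := exists_alternating_trail (v := y) hE hM
    (by simp only [Finsupp.add_apply] at hy; omega)
  · have huw := hu w (evenNbhd_mono hM hF₁ _ ⟨E₁, hE.mono hE₁, h1⟩)
    have hwx : w = x := by
      by_contra hne
      have := h w
      simp only [Finsupp.add_apply, Finsupp.single_eq_of_ne hne] at this h2
      omega
    subst hwx
    obtain ⟨E₂, rfl⟩ := Multiset.le_iff_exists_add.1 hE₁
    refine ⟨E₂ + F₁, (hE.mono (by simp)).add (hM.mono hF₁), ?_, ?_⟩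
    · rw [Multiset.card_add] at hm ⊢
      rw [card_eq_of_degVec_eq h1] at hm
      omega
    · rw [degVec_add, h1] at h
      refine le_of_add_le_add_left (a := Finsupp.single w 1 + Finsupp.single y 1) ?_
      convert h using 1
      · rw [degVec_add]
        abel
      · abel
  · have hcard : E₁.card = F₁.card := by
      have := congrArg Finsupp.degree h1
      simp only [map_add, degree_degVec, Finsupp.degree_single] at this
      omega
    obtain ⟨E₂, rfl⟩ := Multiset.le_iff_exists_add.1 hE₁
    refine exists_drop_edge (E := E₂ + F₁) (x := x) ((hE.mono (by simp)).add (hM.mono hF₁))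
      (by rw [Multiset.card_add] at hm ⊢; omega) fun a => ?_
    have ha := h a
    have h1a := DFunLike.congr_fun h1 a
    simp only [degVec_add, Finsupp.add_apply] at ha h1a h2 ⊢
    by_cases haz : a = z
    · subst haz
      have hay : a ≠ y := by
        rintro rfl
        simp only [degVec_add, Finsupp.add_apply] at hy
        omega
      simp only [Finsupp.single_eq_same, Finsupp.single_eq_of_ne hay] at ha h1a h2 ⊢
      omega
    · rw [Finsupp.single_eq_of_ne haz] at h1a
      omega

end ColonReduction

section ColonPowers

variable {K : Type} [Field K] {V : Type}

/-- The exponents of the monomials in the `n`-th power of the edge ideal of `G`. -/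
def edgePow (G : SimpleGraph V) (n : ℕ) : Set (V →₀ ℕ) :=
  {c | ∃ E, IsEdges G E ∧ E.card = n ∧ degVec E ≤ c}

/-- The exponents of the monomials in the colon ideal `I(G) ^ (|M| + l) : M`, where `M` is
identified with the product of its edges. -/
def colonPow (G : SimpleGraph V) (M : Multiset (Sym2 V)) (l : ℕ) : Set (V →₀ ℕ) :=
  {c | c + degVec M ∈ edgePow G (M.card + l)}

theorem isUpperSet_edgePow (G : SimpleGraph V) (n : ℕ) : IsUpperSet (edgePow G n) :=
  fun _ _ hab ⟨E, h1, h2, h3⟩ => ⟨E, h1, h2, h3.trans hab⟩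

theorem colonPow_zero {G : SimpleGraph V} {M : Multiset (Sym2 V)} (hM : IsEdges G M) :
    colonPow G M 0 = Set.univ :=
  Set.eq_univ_of_forall fun _ => ⟨M, hM, rfl, le_add_self⟩

theorem edgePow_mono {G H : SimpleGraph V} (h : G ≤ H) (n : ℕ) : edgePow G n ⊆ edgePow H n :=
  fun _ ⟨E, h1, h2, h3⟩ => ⟨E, h1.mono_graph h, h2, h3⟩

theorem add_degVec_mem_edgePow {G : SimpleGraph V} {D : Multiset (Sym2 V)} (hD : IsEdges G D)
    {c : V →₀ ℕ} {n : ℕ} (h : c ∈ edgePow G n) : c + degVec D ∈ edgePow G (n + D.card) := by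
  obtain ⟨E, h1, h2, h3⟩ := h
  exact ⟨E + D, h1.add hD, by rw [Multiset.card_add, h2], by rw [degVec_add]; gcongr⟩

open Classical in
theorem add_single_mem_colonPow_iff {G : SimpleGraph V} {M : Multiset (Sym2 V)}
    (hM : IsEdges G M) {x : V} {c : V →₀ ℕ} (hc : ∀ y ∈ evenNbhd G M x, c y = 0) (l : ℕ) :
    c + Finsupp.single x 1 ∈ colonPow G M l ↔
      c ∈ colonPow (isolateNbhd G x) (M.filter (· ∈ (isolateNbhd G x).edgeSet)) l := by
  constructor
  · rintro ⟨E, h1, h2, h3⟩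
    exact exists_isolateNbhd_le h1 hM h2 hc h3
  · intro h
    obtain ⟨D, hD⟩ := Multiset.le_iff_exists_add.1
      (Multiset.filter_le (· ∈ (isolateNbhd G x).edgeSet) M)
    have := add_degVec_mem_edgePow (D := D) (hM.mono (hD ▸ Multiset.le_add_left _ _))
      (edgePow_mono (isolateNbhd_le G x) _ h)
    rw [add_right_comm _ l, add_assoc c, ← degVec_add, ← Multiset.card_add, ← hD] at this
    refine isUpperSet_edgePow G _ ?_ this
    gcongr
    exact le_self_add

theorem mem_colonPow_isolate_iff {G : SimpleGraph V} {M : Multiset (Sym2 V)} {x : V}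
    (hM : degVec M x = 0) {c : V →₀ ℕ} (hc : c x = 0) (l : ℕ) :
    c ∈ colonPow (isolate G x) M l ↔ c ∈ colonPow G M l := by
  refine ⟨fun h => edgePow_mono (isolate_le G x) _ h, ?_⟩
  rintro ⟨E, h1, h2, h3⟩
  refine ⟨E, fun e he => ?_, h2, h3⟩
  have hx : degVec E x = 0 := Nat.le_zero.1 <| (h3 x).trans <| by
    rw [Finsupp.add_apply, hM, hc]
  induction e with
  | _ a b =>
    refine ⟨h1.adj he, ?_, ?_⟩
    · rintro rfl
      exact degVec_ne_zero_of_mem he hx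
    · rintro rfl
      rw [Sym2.eq_swap] at he
      exact degVec_ne_zero_of_mem he hx

theorem colon_colonPow {G : SimpleGraph V} {E M : Multiset (Sym2 V)} {x y : V}
    (h : degVec E = degVec M + Finsupp.single x 1 + Finsupp.single y 1) (l : ℕ) :
    {c | c + Finsupp.single y 1 + Finsupp.single x 1 ∈ colonPow G M (l + 1)} =
      colonPow G E l := by
  ext c
  simp only [colonPow, Set.mem_ofPred_eq, h, card_eq_of_degVec_eq h]
  rw [add_right_comm M.card, add_assoc M.card]
  have : c + Finsupp.single y 1 + Finsupp.single x 1 + degVec M =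
      c + (degVec M + Finsupp.single x 1 + Finsupp.single y 1) := by abel
  rw [this]

theorem colon_colonPow_cons {G : SimpleGraph V} {E M : Multiset (Sym2 V)} {x y v : V}
    (h : degVec E = degVec M + Finsupp.single y 1 + Finsupp.single v 1) (l : ℕ) :
    {c | c + Finsupp.single v 1 ∈ colonPow G (s(x, y) ::ₘ M) l} =
      {c | c + Finsupp.single x 1 ∈ colonPow G E l} := by
  ext c
  simp only [colonPow, Set.mem_ofPred_eq, h, card_eq_of_degVec_eq h, degVec_cons, edgeVec_mk,
    Multiset.card_cons]
  have : c + Finsupp.single v 1 + (Finsupp.single x 1 + Finsupp.single y 1 + degVec M) =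
      c + Finsupp.single x 1 + (degVec M + Finsupp.single y 1 + Finsupp.single v 1) := by abel
  rw [this]

theorem mem_colonPow_cons_iff {G : SimpleGraph V} {M : Multiset (Sym2 V)} {x y : V}
    (hxy : G.Adj x y) (hM : IsEdges G M) {c : V →₀ ℕ} (hc : ∀ v ∈ evenNbhd G M y, c v = 0)
    (l : ℕ) : c ∈ colonPow G (s(x, y) ::ₘ M) l ↔ c ∈ colonPow G M l := by
  have hd : c + degVec (s(x, y) ::ₘ M) =
      c + degVec M + Finsupp.single x 1 + Finsupp.single y 1 := by
    rw [degVec_cons, edgeVec_mk]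
    abel
  constructor
  · rintro ⟨E, h1, h2, h3⟩
    rw [hd] at h3
    rw [Multiset.card_cons] at h2
    exact exists_le_of_even_free h1 hM (by omega) hc h3
  · intro h
    have := add_degVec_mem_edgePow (D := {s(x, y)}) (by simpa [IsEdges] using hxy) h
    change _ ∈ edgePow G _
    rw [hd, Multiset.card_cons, add_right_comm]
    simpa [degVec, add_assoc] using this

theorem Filt.of_splits [Finite V] {W : Set V} {J : Set (V →₀ ℕ)} {r : ℕ} (Y : Set V)
    (h : ∀ v ∈ Y, ∀ W, Filt W {c | c + Finsupp.single v 1 ∈ J} r)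
    (h' : Filt (Y ∪ W) J (r + 1)) : Filt W J (r + 1) := by
  induction Y, Y.toFinite using Set.Finite.induction_on generalizing W with
  | empty => simpa using h'
  | @insert v Y _ _ ih =>
    by_cases hv : v ∈ W
    · refine ih (fun w hw => h w (Set.mem_insert_of_mem _ hw)) ?_
      rwa [Set.insert_union, Set.insert_eq_of_mem (Set.mem_union_right _ hv)] at h'
    · refine .split v hv (h v (Set.mem_insert _ _) W)
        (ih (fun w hw => h w (Set.mem_insert_of_mem _ hw)) ?_)
      rwa [Set.insert_union, ← Set.union_insert] at h'

/-- `Elim G t` says that `G` becomes edgeless by repeatedly removing a vertex or a closed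
neighborhood of a vertex, with at most `t` removals of closed neighborhoods along each branch. -/
inductive Elim : SimpleGraph V → ℕ → Prop
  | bot (t) : Elim ⊥ t
  | step (G x t) (h₁ : Elim (isolate G x) (t + 1)) (h₂ : Elim (isolateNbhd G x) t) :
      Elim G (t + 1)

theorem Filt.colonPow_step [Finite V] {G : SimpleGraph V} {x : V} {t l : ℕ}
    (hnbhd : ∀ M W, IsEdges (isolateNbhd G x) M →
      Filt W (colonPow (isolateNbhd G x) M (l + 1)) (2 * l + t + 1))
    (hvert : ∀ M W, IsEdges (isolate G x) M →
      Filt W (colonPow (isolate G x) M (l + 1)) (2 * l + t + 2))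
    (hl : ∀ M W, IsEdges G M → Filt W (colonPow G M l) (2 * l + t))
    {M : Multiset (Sym2 V)} (hM : IsEdges G M) (W : Set V) :
    Filt W (colonPow G M (l + 1)) (2 * l + t + 2) := by
  classical
  have hcolon : ∀ M W, IsEdges G M →
      Filt W {c | c + Finsupp.single x 1 ∈ colonPow G M (l + 1)} (2 * l + t + 1) := by
    intro M W hM
    refine .of_splits (evenNbhd G M x) ?_ ?_
    · rintro y ⟨E, hE, hd⟩ W
      simp only [Set.mem_ofPred_eq, colon_colonPow hd]
      exact hl E W hE
    · refine .congr (fun c hc => ?_) (hnbhd (M.filter (· ∈ (isolateNbhd G x).edgeSet)) _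
        fun e he => (Multiset.mem_filter.1 he).2)
      exact (add_single_mem_colonPow_iff hM (fun y hy => hc y (Or.inl hy)) _).symm
  have hfree : ∀ W, x ∈ W → ∀ M, degVec M x = 0 → IsEdges G M →
      Filt W (colonPow G M (l + 1)) (2 * l + t + 2) := by
    intro W hx M hMx hM
    refine .congr (fun c hc => mem_colonPow_isolate_iff hMx (hc x hx) _)
      (hvert M W fun e he => ?_)
    induction e with
    | _ a b =>
      refine ⟨hM.adj he, ?_, ?_⟩
      · rintro rfl
        exact degVec_ne_zero_of_mem he hMx
      · rintro rfl
        rw [Sym2.eq_swap] at he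
        exact degVec_ne_zero_of_mem he hMx
  induction hn : M.card generalizing M W with
  | zero =>
    rw [Multiset.card_eq_zero] at hn
    subst hn
    by_cases hx : x ∈ W
    · exact hfree W hx 0 rfl hM
    · exact .split x hx (hcolon 0 W hM) (hfree _ (Set.mem_insert _ _) 0 rfl hM)
  | succ n ih =>
    by_cases hMx : degVec M x = 0
    · by_cases hx : x ∈ W
      · exact hfree W hx M hMx hM
      · exact .split x hx (hcolon M W hM) (hfree _ (Set.mem_insert _ _) M hMx hM)
    · obtain ⟨y, M, rfl⟩ := exists_mem_of_degVec_ne_zero hMx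
      obtain ⟨hxy, hM'⟩ := isEdges_cons.1 hM
      refine .of_splits (evenNbhd G M y) ?_ ?_
      · rintro v ⟨E, hE, hd⟩ W
        rw [colon_colonPow_cons hd]
        exact hcolon E W hE
      · exact .congr (fun c hc => (mem_colonPow_cons_iff hxy hM'
          (fun y hy => hc y (Or.inl hy)) _).symm) (ih hM' _ (by simpa using hn))

theorem Elim.filt_colonPow [Finite V] {G : SimpleGraph V} {t : ℕ} (h : Elim G t) (l : ℕ)
    {M : Multiset (Sym2 V)} (hM : IsEdges G M) (W : Set V) :
    Filt W (colonPow G M (l + 1)) (2 * l + t + 1) := by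
  induction h generalizing l M W with
  | bot t =>
    convert Filt.zero W _
    refine Set.eq_empty_of_forall_notMem ?_
    rintro c ⟨E, h1, h2, -⟩
    obtain ⟨e, he⟩ := Multiset.card_pos_iff_exists_mem.1 (by omega : 0 < E.card)
    simpa using h1 e he
  | step G x t h₁ h₂ ih₁ ih₂ =>
    induction l generalizing M W with
    | zero =>
      refine .colonPow_step (fun M W hM => ih₂ 0 hM W) (fun M W hM => ih₁ 0 hM W)
        (fun M W hM => ?_) hM W
      rw [colonPow_zero hM]
      exact .unit W _
    | succ l ih =>
      refine .colonPow_step (fun M W hM => ih₂ (l + 1) hM W) (fun M W hM => ih₁ (l + 1) hM W)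
        (fun M W hM => ?_) hM W
      convert ih hM W using 1
      ring

theorem edgeIdeal_pow (G : SimpleGraph V) (n : ℕ) :
    edgeIdeal K G ^ n = monIdeal K (edgePow G n) := by
  have hgen : edgeIdeal K G = Ideal.span
      ((fun c => MvPolynomial.monomial c 1) '' {c | ∃ e ∈ G.edgeSet, c = edgeVec e}) := by
    refine congrArg Ideal.span (Set.ext fun m => ?_)
    constructor
    · rintro ⟨u, v, h, rfl⟩
      exact ⟨_, ⟨s(u, v), h, rfl⟩, by simp [MvPolynomial.X, MvPolynomial.monomial_mul]⟩
    · rintro ⟨_, ⟨e, he, rfl⟩, rfl⟩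
      induction e with
      | _ u v => exact ⟨u, v, he, by simp [MvPolynomial.X, MvPolynomial.monomial_mul]⟩
  have hspan : ∀ n, edgeIdeal K G ^ n = Ideal.span
      ((fun c => MvPolynomial.monomial c 1) '' {c | ∃ E, IsEdges G E ∧ E.card = n ∧
        c = degVec E}) := by
    intro n
    induction n with
    | zero =>
      rw [pow_zero, Ideal.one_eq_top, eq_comm, Ideal.eq_top_iff_one]
      exact Ideal.subset_span ⟨0, ⟨0, isEdges_zero G, rfl, rfl⟩, rfl⟩
    | succ n ih =>
      rw [pow_succ', ih, hgen, Ideal.span_mul_span']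
      refine congrArg Ideal.span (Set.ext fun m => ?_)
      rw [Set.mem_mul]
      constructor
      · rintro ⟨_, ⟨_, ⟨e, he, rfl⟩, rfl⟩, _, ⟨_, ⟨E, hE, hn, rfl⟩, rfl⟩, rfl⟩
        induction e with
        | _ u v =>
          exact ⟨_, ⟨s(u, v) ::ₘ E, hE.cons he, by simp [hn], rfl⟩,
            by simp [MvPolynomial.monomial_mul]⟩
      · rintro ⟨_, ⟨E, hE, hn, rfl⟩, rfl⟩
        obtain ⟨e, he⟩ := Multiset.card_pos_iff_exists_mem.1 (by omega : 0 < E.card)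
        obtain ⟨E, rfl⟩ := Multiset.exists_cons_of_mem he
        exact ⟨_, ⟨_, ⟨e, hE e he, rfl⟩, rfl⟩, _, ⟨_, ⟨E, hE.mono (Multiset.le_cons_self _ _),
          by simpa using hn, rfl⟩, rfl⟩, by simp [MvPolynomial.monomial_mul]⟩
  ext p
  rw [hspan, show Ideal.span _ = monIdeal K _ from rfl, mem_monIdeal_iff_exists_le,
    mem_monIdeal (isUpperSet_edgePow G n)]
  refine forall₂_congr fun μ _ => ⟨?_, ?_⟩
  · rintro ⟨_, ⟨E, h1, h2, rfl⟩, h3⟩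
    exact ⟨E, h1, h2, h3⟩
  · rintro ⟨E, h1, h2, h3⟩
    exact ⟨_, ⟨E, h1, h2, rfl⟩, h3⟩

theorem Elim.reg_edgeIdeal_pow_le [Finite V] {G : SimpleGraph V} {t : ℕ} (h : Elim G t) {s : ℕ}
    (hs : 1 ≤ s) : reg K (edgeIdeal K G ^ s) ≤ 2 * s + t - 1 := by
  obtain ⟨l, rfl⟩ := Nat.exists_eq_add_of_le' hs
  refine Nat.sInf_le ?_
  have := h.filt_colonPow l (isEdges_zero G) ∅
  rw [show colonPow G 0 (l + 1) = edgePow G (l + 1) by simp [colonPow]] at this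
  rw [Set.mem_ofPred_eq, edgeIdeal_pow]
  convert this.hasResolutionDegreeBound (isUpperSet_edgePow G (l + 1)) using 1
  omega

end ColonPowers

section Cochordal

variable {V : Type}

theorem cycleGraph_adj_of_lt {n : ℕ} {i j : Fin n} (h : i < j) :
    (cycleGraph n).Adj i j ↔ j.val = i.val + 1 ∨ (i.val + n = j.val + 1) := by
  have h1 := Fin.sub_val_of_le h.le
  have h2 := Fin.coe_sub_iff_lt.2 h
  rw [cycleGraph_adj', h1, h2]
  have : i.val < j.val := h
  omega

/-- The spanning subgraph of `G` whose edges are the edges of `G` inside `X`. -/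
def within (G : SimpleGraph V) (X : Set V) : SimpleGraph V where
  Adj a b := G.Adj a b ∧ a ∈ X ∧ b ∈ X
  symm := ⟨fun _ _ h => ⟨h.1.symm, h.2.2, h.2.1⟩⟩
  loopless := ⟨fun _ h => h.1.ne rfl⟩

theorem getVert_mem_of_within {G : SimpleGraph V} {X : Set V} {a b : V}
    (p : (within G X).Walk a b) (ha : a ∈ X) (i : ℕ) : p.getVert i ∈ X := by
  by_cases hi : i < p.length
  · exact (p.adj_getVert_succ hi).2.1
  · obtain rfl | ⟨j, rfl⟩ : i = 0 ∨ ∃ j, i = j + 1 := by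
      cases i <;> simp
    · rwa [p.getVert_zero]
    · rw [p.getVert_of_length_le (not_lt.1 hi)]
      cases p with
      | nil => exact ha
      | cons h p =>
        have := (p.cons h).adj_getVert_succ (i := p.length) (by simp)
        rw [← SimpleGraph.Walk.length_cons h p, SimpleGraph.Walk.getVert_length] at this
        exact this.2.2

theorem dist_getVert {G : SimpleGraph V} {a b : V} {p : G.Walk a b} (hp : p.length = G.dist a b)
    {i : ℕ} (hi : i ≤ p.length) : G.dist a (p.getVert i) = i := by
  refine le_antisymm ?_ ?_
  · have := SimpleGraph.dist_le (p.take i)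
    rwa [SimpleGraph.Walk.take_length, min_eq_left hi] at this
  · have h1 := (p.take i).reachable.dist_triangle_left b
    have h2 := SimpleGraph.dist_le (p.drop i)
    rw [SimpleGraph.Walk.drop_length] at h2
    omega

theorem IsChordal.adj_of_reachable_within {C : SimpleGraph V} (hC : IsChordal C) {X : Set V}
    {v s t : V} (hs : s ∈ X) (hvs : C.Adj v s) (hvt : C.Adj v t)
    (hX : ∀ x ∈ X, C.Adj v x → x = s ∨ x = t) (hv : v ∉ X) (hst : s ≠ t)
    (h : (within C X).Reachable s t) : C.Adj s t := by
  by_contra hnadj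
  obtain ⟨p, hp⟩ := h.exists_walk_length_eq_dist
  have hmem := getVert_mem_of_within p hs
  have hdist := @dist_getVert _ _ _ _ p hp
  have hk : 2 ≤ p.length := by
    rw [hp]
    exact h.one_lt_dist_of_ne_of_not_adj hst fun h' => hnadj h'.1
  have hinj : ∀ i j, i < j → j ≤ p.length → p.getVert i ≠ p.getVert j := by
    intro i j hij hj heq
    have h1 := hdist hj
    rw [← heq, hdist (by omega)] at h1
    omega
  have hadj : ∀ i j, i < j → j ≤ p.length →
      (C.Adj (p.getVert i) (p.getVert j) ↔ j = i + 1) := by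
    intro i j hij hj
    constructor
    · intro h'
      have h1 := (show (within C X).Adj (p.getVert i) (p.getVert j) from
        ⟨h', hmem i, hmem j⟩).diff_dist_adj (u := s)
      rw [hdist hj, hdist (by omega)] at h1
      omega
    · rintro rfl
      exact (p.adj_getVert_succ (by omega)).1
  let f : Fin (p.length + 2) → V := fun i => if i.val ≤ p.length then p.getVert i else v
  have hf : ∀ i j : Fin (p.length + 2), i < j → f i ≠ f j ∧
      (C.Adj (f i) (f j) ↔ (cycleGraph (p.length + 2)).Adj i j) := by
    intro i j hij
    rw [cycleGraph_adj_of_lt hij]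
    have hij' : i.val < j.val := hij
    have hj := j.isLt
    have hi : i.val ≤ p.length := by omega
    by_cases hjp : j.val ≤ p.length
    · simp only [f, if_pos hi, if_pos hjp]
      refine ⟨hinj _ _ hij' hjp, ?_⟩
      rw [hadj _ _ hij' hjp]
      omega
    · simp only [f, if_pos hi, if_neg hjp]
      refine ⟨fun h' => hv (h' ▸ hmem i), ?_⟩
      constructor
      · intro h'
        have hst' := hX _ (hmem i) h'.symm
        have h0 : i.val = 0 ∨ i.val = p.length := by
          by_contra! hne
          rcases hst' with h1 | h1
          · refine hinj 0 i (by omega) hi ?_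
            rw [p.getVert_zero, h1]
          · refine hinj i p.length (by omega) le_rfl ?_
            rw [p.getVert_length, h1]
        omega
      · intro h'
        have h0 : i.val = 0 ∨ i.val = p.length := by omega
        rcases h0 with h0 | h0
        · rw [h0, p.getVert_zero]
          exact hvs.symm
        · rw [h0, p.getVert_length]
          exact hvt.symm
  refine (hC (p.length + 2) (by omega)).false ⟨⟨f, fun i j hij => ?_⟩, @fun i j => ?_⟩
  · by_contra hne
    rcases lt_or_gt_of_ne hne with h' | h'
    · exact (hf i j h').1 hij
    · exact (hf j i h').1 hij.symm
  · change C.Adj (f i) (f j) ↔ _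
    rcases lt_trichotomy i j with h' | rfl | h'
    · exact (hf i j h').2
    · simp
    · rw [SimpleGraph.adj_comm, (hf j i h').2, SimpleGraph.adj_comm]

/-- The vertex `z` is simplicial in the subgraph of `C` induced on `U`. -/
def IsSimplicial (C : SimpleGraph V) (U : Finset V) (z : V) : Prop :=
  ∀ a ∈ U, ∀ b ∈ U, C.Adj z a → C.Adj z b → a ≠ b → C.Adj a b

/-- Dirac's theorem. -/
theorem IsChordal.exists_isSimplicial_of_not_adj {C : SimpleGraph V} (hC : IsChordal C)
    {U : Finset V} {v u : V} (hv : v ∈ U) (hu : u ∈ U) (huv : u ≠ v) (hnadj : ¬ C.Adj v u) :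
    ∃ z ∈ U, z ≠ v ∧ ¬ C.Adj v z ∧ IsSimplicial C U z := by
  classical
  induction hn : U.card using Nat.strong_induction_on generalizing U v u with
  | _ n ih =>
    let A : Set V := {a | a ∈ U ∧ a ≠ v ∧ ¬ C.Adj v a}
    let B := U.filter fun a => a ∈ A ∧ (within C A).Reachable u a
    have hBU : B ⊆ U := Finset.filter_subset _ _
    have hBA : ∀ b ∈ B, b ∈ A := fun b hb => (Finset.mem_filter.1 hb).2.1
    have huB : u ∈ B := by simp [B, A, hu, huv, hnadj]
    have hBadj : ∀ b ∈ B, ∀ a ∈ A, C.Adj b a → a ∈ B := by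
      intro b hb a ha hab
      rw [Finset.mem_filter] at hb ⊢
      exact ⟨ha.1, ha, hb.2.2.trans
        (SimpleGraph.Adj.reachable (G := within C A) ⟨hab, hb.2.1, ha⟩)⟩
    have hBconn : ∀ a ∈ B, ∀ b ∈ B, (within C B).Reachable a b := by
      have key : ∀ a b, (within C A).Walk a b → a ∈ B → (within C B).Reachable a b := by
        intro a b p
        induction p with
        | nil => exact fun _ => .rfl
        | cons h p ih' =>
          intro ha
          have hb := hBadj _ ha _ h.2.2 h.1
          exact (SimpleGraph.Adj.reachable (G := within C B) ⟨h.1, ha, hb⟩).trans (ih' hb)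
      intro a ha b hb
      obtain ⟨p⟩ := (Finset.mem_filter.1 ha).2.2.symm.trans (Finset.mem_filter.1 hb).2.2
      exact key a b p ha
    let S := U.filter fun s => C.Adj v s ∧ ∃ b ∈ B, C.Adj b s
    have hS : ∀ s ∈ S, s ∈ U ∧ C.Adj v s ∧ ∃ b ∈ B, C.Adj b s := fun s hs =>
      Finset.mem_filter.1 hs
    have hnbr : ∀ z ∈ B, ∀ a ∈ U, C.Adj z a → a ∈ B ∪ S := by
      intro z hz a ha hza
      by_cases haA : a ∈ A
      · exact Finset.mem_union_left _ (hBadj z hz a haA hza)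
      · refine Finset.mem_union_right _ (Finset.mem_filter.2 ⟨ha, ?_, z, hz, hza⟩)
        by_contra hva
        refine haA ⟨ha, ?_, hva⟩
        rintro rfl
        exact (hBA z hz).2.2 hza.symm
    have hclique : ∀ s ∈ S, ∀ t ∈ S, s ≠ t → C.Adj s t := by
      intro s hs t ht hst
      obtain ⟨-, hvs, b, hb, hbs⟩ := hS s hs
      obtain ⟨-, hvt, b', hb', hbt⟩ := hS t ht
      refine hC.adj_of_reachable_within (X := insert s (insert t (B : Set V)))
        (Set.mem_insert _ _) hvs hvt ?_ ?_ hst ?_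
      · rintro x (rfl | rfl | hx) hvx
        · exact Or.inl rfl
        · exact Or.inr rfl
        · exact absurd hvx (hBA x hx).2.2
      · rintro (rfl | rfl | hx)
        · exact hvs.ne rfl
        · exact hvt.ne rfl
        · exact (hBA v hx).2.1 rfl
      · have hle : within C B ≤ within C (insert s (insert t (B : Set V))) :=
          fun _ _ h => ⟨h.1, by simp [h.2.1], by simp [h.2.2]⟩
        have h1 : (within C (insert s (insert t (B : Set V)))).Adj s b :=
          ⟨hbs.symm, by simp, by simp [hb]⟩
        have h2 : (within C (insert s (insert t (B : Set V)))).Adj b' t :=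
          ⟨hbt, by simp [hb'], by simp⟩
        exact h1.reachable.trans (((hBconn b hb b' hb').mono hle).trans h2.reachable)
    have hvBS : v ∉ B ∪ S := by
      rw [Finset.mem_union, not_or]
      exact ⟨fun h => (hBA v h).2.1 rfl, fun h => (hS v h).2.1.ne rfl⟩
    have hBSU : B ∪ S ⊆ U := Finset.union_subset hBU (Finset.filter_subset _ _)
    have hcard : (B ∪ S).card < n := hn ▸ Finset.card_lt_card
      ((Finset.ssubset_iff_of_subset hBSU).2 ⟨v, hv, hvBS⟩)
    suffices ∃ z ∈ B, IsSimplicial C (B ∪ S) z by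
      obtain ⟨z, hz, hzs⟩ := this
      exact ⟨z, hBU hz, (hBA z hz).2.1, (hBA z hz).2.2, fun a ha b hb hza hzb =>
        hzs a (hnbr z hz a ha hza) b (hnbr z hz b hb hzb) hza hzb⟩
    by_cases hfull : ∀ s ∈ S, ∀ a ∈ B ∪ S, a ≠ s → C.Adj s a
    · have hlift : ∀ z, IsSimplicial C B z → IsSimplicial C (B ∪ S) z := by
        intro z hz a ha b hb hza hzb hab
        by_cases haS : a ∈ S
        · exact hfull a haS b hb hab.symm
        by_cases hbS : b ∈ S
        · exact (hfull b hbS a ha hab).symm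
        exact hz a ((Finset.mem_union.1 ha).resolve_right haS) b
          ((Finset.mem_union.1 hb).resolve_right hbS) hza hzb hab
      by_cases hBc : ∀ a ∈ B, ∀ b ∈ B, a ≠ b → C.Adj a b
      · exact ⟨u, huB, hlift u fun a ha b hb _ _ hab => hBc a ha b hb hab⟩
      · push Not at hBc
        obtain ⟨a, ha, b, hb, hab, hnab⟩ := hBc
        obtain ⟨z, hz, -, -, hzs⟩ := ih B.card
          ((Finset.card_le_card Finset.subset_union_left).trans_lt hcard) ha hb hab.symm hnab rfl
        exact ⟨z, hz, hlift z hzs⟩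
    · push Not at hfull
      obtain ⟨s, hs, a, ha, has, hnsa⟩ := hfull
      obtain ⟨z, hz, hzs, hnsz, hsimp⟩ := ih _ hcard (Finset.mem_union_right _ hs) ha has hnsa rfl
      exact ⟨z, (Finset.mem_union.1 hz).resolve_right fun hzS => hnsz (hclique s hs z hzS hzs.symm),
        hsimp⟩

theorem IsChordal.exists_isSimplicial {C : SimpleGraph V} (hC : IsChordal C) {U : Finset V}
    (hU : U.Nonempty) : ∃ z ∈ U, IsSimplicial C U z := by
  by_cases h : ∀ a ∈ U, ∀ b ∈ U, a ≠ b → C.Adj a b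
  · obtain ⟨z, hz⟩ := hU
    exact ⟨z, hz, fun a ha b hb _ _ => h a ha b hb⟩
  · push Not at h
    obtain ⟨a, ha, b, hb, hab, hnab⟩ := h
    obtain ⟨z, hz, -, -, hzs⟩ := hC.exists_isSimplicial_of_not_adj ha hb hab.symm hnab
    exact ⟨z, hz, hzs⟩

theorem IsCochordal.exists_dominating {f : SimpleGraph V} (hf : IsCochordal f) {U : Finset V}
    (hU : U.Nonempty) : ∃ x ∈ U, ∀ a ∈ U, ∀ b ∈ U, a ≠ x → b ≠ x → f.Adj a b →
      f.Adj x a ∨ f.Adj x b := by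
  obtain ⟨x, hx, hs⟩ := hf.exists_isSimplicial hU
  refine ⟨x, hx, fun a ha b hb hax hbx hab => ?_⟩
  by_contra! hne
  exact (hs a ha b hb ⟨hax.symm, hne.1⟩ ⟨hbx.symm, hne.2⟩ hab.ne).2 hab

theorem elim_within {G : SimpleGraph V} {t : ℕ} {f : Fin t → SimpleGraph V} (U : Finset V)
    (hf : ∀ i, f i ≤ G ∧ IsCochordal (f i))
    (hcov : ∀ u ∈ U, ∀ v ∈ U, G.Adj u v → ∃ i, (f i).Adj u v) : Elim (within G U) t := by
  classical
  induction hn : U.card using Nat.strong_induction_on generalizing U t with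
  | _ n ih =>
    cases t with
    | zero =>
      rw [show within G U = ⊥ from eq_bot_iff.2 fun a b h =>
        (hcov a h.2.1 b h.2.2 h.1).elim fun i => i.elim0]
      exact .bot 0
    | succ t =>
      rcases U.eq_empty_or_nonempty with rfl | hU
      · rw [show within G (∅ : Finset V) = ⊥ from eq_bot_iff.2 fun a b h => by
          simpa using h.2.1]
        exact .bot _
      obtain ⟨x, hx, hdom⟩ := (hf 0).2.exists_dominating hU
      have hlt : (U.erase x).card < n := hn ▸ Finset.card_erase_lt_of_mem hx
      refine .step _ x t ?_ ?_
      · rw [show isolate (within G U) x = within G (U.erase x) by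
          ext a b
          simp only [isolate, within, Finset.coe_erase, Set.mem_sdiff, Set.mem_singleton_iff]
          tauto]
        exact ih _ hlt _ hf (fun u hu v hv => hcov u (Finset.mem_of_mem_erase hu) v
          (Finset.mem_of_mem_erase hv)) rfl
      · have hsub : (U.erase x).filter (fun a => ¬ G.Adj x a) ⊆ U.erase x :=
          Finset.filter_subset _ _
        rw [show isolateNbhd (within G U) x =
            within G ((U.erase x).filter fun a => ¬ G.Adj x a : Finset V) by
          ext a b
          simp only [isolateNbhd, within, Finset.mem_coe, Finset.mem_filter, Finset.mem_erase]
          constructor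
          · rintro ⟨⟨h1, h2, h3⟩, h4, h5⟩
            have h6 : ¬ G.Adj x a := fun h => h4 ⟨h, hx, h2⟩
            have h7 : ¬ G.Adj x b := fun h => h5 ⟨h, hx, h3⟩
            refine ⟨h1, ⟨⟨?_, h2⟩, h6⟩, ⟨⟨?_, h3⟩, h7⟩⟩
            · rintro rfl
              exact h7 h1
            · rintro rfl
              exact h6 h1.symm
          · rintro ⟨h1, ⟨⟨_, h2⟩, h3⟩, ⟨⟨_, h4⟩, h5⟩⟩
            exact ⟨⟨h1, h2, h4⟩, fun h => h3 h.1, fun h => h5 h.1⟩]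
        refine ih _ ((Finset.card_le_card hsub).trans_lt hlt) _ (f := fun i => f i.succ)
          (fun i => hf _) (fun u hu v hv huv => ?_) rfl
        simp only [Finset.mem_filter, Finset.mem_erase] at hu hv
        obtain ⟨i, hi⟩ := hcov u hu.1.2 v hv.1.2 huv
        cases i using Fin.cases with
        | zero =>
          rcases hdom u hu.1.2 v hv.1.2 hu.1.1 hv.1.1 hi with h | h
          · exact absurd ((hf 0).1 h) hu.2
          · exact absurd ((hf 0).1 h) hv.2
        | succ i => exact ⟨i, hi⟩

theorem isCochordal_fromEdgeSet_singleton (e : Sym2 V) :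
    IsCochordal (SimpleGraph.fromEdgeSet {e}) := by
  refine fun n hn => ⟨fun φ => ?_⟩
  have key : ∀ i j : Fin n, i < j → j.val ≠ i.val + 1 → i.val + n ≠ j.val + 1 →
      s(φ i, φ j) = e := by
    intro i j hij h1 h2
    have h3 : ¬ (SimpleGraph.fromEdgeSet {e})ᶜ.Adj (φ i) (φ j) := by
      rw [φ.map_adj_iff, cycleGraph_adj_of_lt hij]
      omega
    rw [SimpleGraph.compl_adj, not_and, not_not] at h3
    have h4 := h3 (φ.injective.ne hij.ne)
    rw [SimpleGraph.fromEdgeSet_adj] at h4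
    exact h4.1
  have h02 := key ⟨0, by omega⟩ ⟨2, by omega⟩ (by simp) (by simp) (by simp; omega)
  have h13 := key ⟨1, by omega⟩ ⟨3, by omega⟩ (by simp) (by simp) (by simp; omega)
  have h := h02.trans h13.symm
  simp [φ.injective.eq_iff] at h

theorem exists_cochordal_cover [Finite V] (G : SimpleGraph V) :
    ∃ f : Fin (cochord G) → SimpleGraph V,
      (∀ i, f i ≤ G ∧ IsCochordal (f i)) ∧ ∀ ⦃u v : V⦄, G.Adj u v → ∃ i, (f i).Adj u v := by
  refine Nat.sInf_mem (s := { t | ∃ f : Fin t → SimpleGraph V,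
    (∀ i, f i ≤ G ∧ IsCochordal (f i)) ∧ ∀ ⦃u v : V⦄, G.Adj u v → ∃ i, (f i).Adj u v }) ?_
  obtain ⟨t, ⟨σ⟩⟩ := Finite.exists_equiv_fin G.edgeSet
  refine ⟨t, fun i => SimpleGraph.fromEdgeSet {(σ.symm i : Sym2 V)}, fun i =>
    ⟨fun a b h => ?_, isCochordal_fromEdgeSet_singleton _⟩, fun u v h => ⟨σ ⟨s(u, v), h⟩, ?_⟩⟩
  · rw [SimpleGraph.fromEdgeSet_adj, Set.mem_singleton_iff] at h
    rw [← SimpleGraph.mem_edgeSet, h.1]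
    exact (σ.symm i).2
  · simp [SimpleGraph.fromEdgeSet_adj, h.ne]

theorem elim_cochord [Finite V] (G : SimpleGraph V) : Elim G (cochord G) := by
  have := Fintype.ofFinite V
  obtain ⟨f, hf, hcov⟩ := exists_cochordal_cover G
  have := elim_within Finset.univ hf fun u _ v _ h => hcov h
  rwa [show within G (Finset.univ : Finset V) = G by ext; simp [within]] at this

end Cochordal

/-- For every finite simple graph `G` and every `s ≥ 1`,
`reg(I(G)^s) ≤ 2s + cochord(G) - 1`. -/
theorem stmt7 (K : Type) [Field K] {V : Type} [Fintype V] (G : SimpleGraph V)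
    (s : ℕ) (hs : 1 ≤ s) :
    reg K ((edgeIdeal K G) ^ s) ≤ 2 * s + cochord G - 1 := by
  exact (elim_cochord G).reg_edgeIdeal_pow_le hs

end Paper
end
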